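/- There exists δ > 0 with the following property. Let φ : [0,∞) × ℝ → ℝ be twice continuously differentiable and solve the variable-coefficient wave equation ∂ₜ²φ(t,x) − ∂ₓ²φ(t,x) − Q̃(x)²·(φ(t,x) − φ(t,x)³) = 0 for all t ≥ 0 and x ∈ ℝ. Assume that for every t ≥ 0 the functions x ↦ ∂ₓφ(t,x) − H̃'(x), x ↦ Q̃(x)·(φ(t,x) − H̃(x)), x ↦ Q̃(x)·(1 − φ(t,x)²), and x ↦ ∂ₜφ(t,x) all belong to L²(ℝ), and that sup over t ≥ 0 of ( ∫(∂ₓφ(t,x) − H̃'(x))² dx + ∫Q̃(x)²·(φ(t,x) − H̃(x))² dx + ∫(∂ₜφ(t,x))² dx )^{1/2} is strictly less than δ. Then for every bounded interval I ⊂ ℝ, the quantity ∫_I [ (φ(t,x) − H̃(x))² + (∂ₓφ(t,x) − H̃'(x))² + (∂ₜφ(t,x))² ] dx tends to 0 as t → ∞. -/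

import Mathlib

open Real MeasureTheory Filter

noncomputable def Qs (x : ℝ) : ℝ := (3/2) * (1 / Real.cosh (x/2))^2
noncomputable def Hs (x : ℝ) : ℝ := Real.tanh (x/2)
noncomputable def alphaFn (x : ℝ) : ℝ := (1/3) * (Real.sinh x + x)
noncomputable def alphaInv : ℝ → ℝ := Function.invFun alphaFn
noncomputable def Qt (x : ℝ) : ℝ := Qs (alphaInv x)
noncomputable def Ht (x : ℝ) : ℝ := Hs (alphaInv x)
noncomputable def Vpot (x : ℝ) : ℝ := 2 * (Qt x)^2 * (1 - Qt x)

namespace Kink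

open Polynomial

/-- `1 - X ^ 2`. -/
noncomputable def pW : ℝ[X] := 1 - X ^ 2

/-- The derivation on polynomials in the kink profile `h` induced by
`h' = (3/4) (1 - h ^ 2) ^ 2`. -/
noncomputable def pD (A : ℝ[X]) : ℝ[X] := C (3/4) * pW ^ 2 * derivative A

/-- The virial multiplier, in terms of the kink profile. -/
noncomputable def pPsi : ℝ[X] := X + X ^ 3 + 4 * X ^ 5

/-- The zeroth-order multiplier of the momentum functional. -/
noncomputable def pG : ℝ[X] := C (9/10) * pD pPsi

/-- The coefficient of the gradient term kept in the virial quadratic form. -/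
noncomputable def pA : ℝ[X] := C (189/200) * pD pPsi

/-- The distorted soliton `Qt`, in terms of the kink profile. -/
noncomputable def pQ : ℝ[X] := C (3/2) * pW

/-- The linearized potential `Vpot`, in terms of the kink profile. -/
noncomputable def pV : ℝ[X] := 2 * pQ ^ 2 * (1 - pQ)

/-- The zeroth-order coefficient of the virial quadratic form. -/
noncomputable def pB : ℝ[X] :=
  C (1/2) * (pG - pD pPsi) * pV - C (1/2) * pPsi * pD pV - C (1/4) * pD (pD pG)

/-- The approximate internal mode. -/
noncomputable def pY : ℝ[X] := pW ^ 4 * (7 - 12 * pW + C (23/4) * pW ^ 2)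

/-- The trial direction split off from the perturbation in the virial form. -/
noncomputable def pF : ℝ[X] := pW * (1 - pW + C (1/2) * pW ^ 2)

noncomputable def pT : ℝ[X] :=
  C (9/4) * pW - 12 * pW ^ 2 + C (75/4) * pW ^ 3 - 12 * pW ^ 4

/-- `X` times the logarithmic derivative used to complete the square in the virial form. -/
noncomputable def pN : ℝ[X] := C (3/4) * pW ^ 2 + X ^ 2 * pT

/-- The residual of `pY` in the eigenvalue equation with eigenvalue `-6/5`. -/
noncomputable def pR : ℝ[X] := pV * pY - pD (pD pY) + C (6/5) * pY

noncomputable def pBf : ℝ[X] := pB * pF - pD (pA * pD pF)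

noncomputable def pL : ℝ[X] := 2 * pBf + C (5/4) * pY

noncomputable def pRes : ℝ[X] :=
  C (17523/3200) + C (-484407/6400) * X ^ 2 + C (6636681/12800) * X ^ 4
  + C (-25754679/12800) * X ^ 6 + C (70590447/12800) * X ^ 8 + C (-69487551/6400) * X ^ 10
  + C (3750705/256) * X ^ 12
  + C (-188367039/12800) * X ^ 14 + C (8047431/640) * X ^ 16 + C (-760347/100) * X ^ 18
  + C (10206/5) * X ^ 20

noncomputable def pE : ℝ[X] := pB - pW ^ 3 * pRes

theorem X_sq_mul_pE (x : ℝ) : x ^ 2 * pE.eval x =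
    x * (pD (pA * pN)).eval x - (pA * pN).eval x * (3/4 * (1 - x ^ 2) ^ 2)
      + (pA * pN ^ 2).eval x := by
  simp [pE, pB, pA, pN, pG, pV, pQ, pD, pPsi, pW, pT, pRes, derivative_pow]
  ring

noncomputable def pLh : ℝ[X] :=
  C (2607/1600) + C (-49991/1600) * X ^ 2 + C (405429/1600) * X ^ 4 + C (-781757/800) * X ^ 6
  + C (366363/160) * X ^ 8 + C (-2777193/800) * X ^ 10 + C (477009/160) * X ^ 12
  + C (-334773/320) * X ^ 14

noncomputable def pRh : ℝ[X] :=
  C (81/40) + C (-1221/20) * X ^ 2 + C (19917/40) * X ^ 4 + C (-16719/10) * X ^ 6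
  + C (21087/8) * X ^ 8 + C (-7785/4) * X ^ 10 + C (4347/8) * X ^ 12

theorem eval_pL (x : ℝ) : pL.eval x = (1 - x ^ 2) ^ 3 * pLh.eval x := by
  simp [pL, pLh, pBf, pB, pA, pY, pF, pG, pV, pQ, pD, pPsi, pW, derivative_pow]
  ring

theorem eval_pR (x : ℝ) : pR.eval x = (1 - x ^ 2) ^ 3 * pRh.eval x := by
  simp [pR, pRh, pY, pV, pQ, pD, pW, derivative_pow]
  ring

/-- The value of `pRes` at `x`, as a polynomial in `t = x ^ 2`. -/
noncomputable def residual (t : ℝ) : ℝ :=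
  (17523/3200) + (-484407/6400) * t + (6636681/12800) * t ^ 2
  + (-25754679/12800) * t ^ 3 + (70590447/12800) * t ^ 4 + (-69487551/6400) * t ^ 5
  + (3750705/256) * t ^ 6 + (-188367039/12800) * t ^ 7 + (8047431/640) * t ^ 8
  + (-760347/100) * t ^ 9
  + (10206/5) * t ^ 10

theorem le_residual {t : ℝ} (h0 : 0 ≤ t) (h1 : t ≤ 1) :
    101/100 ≤ residual t := by
  have h2 : 0 ≤ t → t ≤ 9/40 → 101/100 ≤ residual t := by
    intro hl hr
    obtain ⟨x, hx⟩ : ∃ x, x = t - 0 := ⟨_, rfl⟩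
    obtain ⟨y, hy⟩ : ∃ y, y = 9/40 - t := ⟨_, rfl⟩
    have hx0 : 0 ≤ x := by linarith
    have hy0 : 0 ≤ y := by linarith
    have key : (3486784401/10485760000000000) * (residual t - 101/100) =
        14291/3200 * x ^ 0 * y ^ 10 + 7073137/256000 * x ^ 1 * y ^ 9
         + 1514421801/20480000 * x ^ 2 * y ^ 8 + 90033952929/819200000 * x ^ 3 * y ^ 7
         + 3145556682087/32768000000 * x ^ 4 * y ^ 6 + 30678812516241/655360000000 * x ^ 5 * y ^ 5
         + 10403915931273/1048576000000 * x ^ 6 * y ^ 4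
         + 845473173673209/2097152000000000 * x ^ 7 * y ^ 3
         + 967833280115001/838860800000000 * x ^ 8 * y ^ 2
         + 11990186414296271/13107200000000000 * x ^ 9 * y ^ 1
         + 3819994002341741/20971520000000000 * x ^ 10 * y ^ 0 := by
      subst hx hy
      rw [residual]
      ring
    have pos : 0 ≤ (3486784401/10485760000000000) * (residual t - 101/100) := by
      rw [key]; positivity
    linarith [nonneg_of_mul_nonneg_right pos (by norm_num)]
  have h3 : 9/40 ≤ t → t ≤ 23/40 → 101/100 ≤ residual t := by
    intro hl hr
    obtain ⟨x, hx⟩ : ∃ x, x = t - 9/40 := ⟨_, rfl⟩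
    obtain ⟨y, hy⟩ : ∃ y, y = 23/40 - t := ⟨_, rfl⟩
    have hx0 : 0 ≤ x := by linarith
    have hy0 : 0 ≤ y := by linarith
    have key : (282475249/10240000000000) * (residual t - 101/100) =
        3819994002341741/20971520000000000 * x ^ 0 * y ^ 10
         + 169449568016212211/52428800000000000 * x ^ 1 * y ^ 9
         + 2474150860030845681/104857600000000000 * x ^ 2 * y ^ 8
         + 1124744409285583191/13107200000000000 * x ^ 3 * y ^ 7
         + 9333252362971085577/52428800000000000 * x ^ 4 * y ^ 6
         + 5807969581633748613/26214400000000000 * x ^ 5 * y ^ 5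
         + 8595745108708920477/52428800000000000 * x ^ 6 * y ^ 4
         + 876654842217842499/13107200000000000 * x ^ 7 * y ^ 3
         + 1276839032139043821/104857600000000000 * x ^ 8 * y ^ 2
         + 21552307924157339/52428800000000000 * x ^ 9 * y ^ 1
         + 2895550918898869/104857600000000000 * x ^ 10 * y ^ 0 := by
      subst hx hy
      rw [residual]
      ring
    have pos : 0 ≤ (282475249/10240000000000) * (residual t - 101/100) := by
      rw [key]; positivity
    linarith [nonneg_of_mul_nonneg_right pos (by norm_num)]
  have h4 : 23/40 ≤ t → t ≤ 1 → 101/100 ≤ residual t := by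
    intro hl hr
    obtain ⟨x, hx⟩ : ∃ x, x = t - 23/40 := ⟨_, rfl⟩
    obtain ⟨y, hy⟩ : ∃ y, y = 1 - t := ⟨_, rfl⟩
    have hx0 : 0 ≤ x := by linarith
    have hy0 : 0 ≤ y := by linarith
    have key : (2015993900449/10485760000000000) * (residual t - 101/100) =
        2895550918898869/104857600000000000 * x ^ 0 * y ^ 10
         + 2943612775666069/26214400000000000 * x ^ 1 * y ^ 9
         + 295693251844294629/20971520000000000 * x ^ 2 * y ^ 8
         + 61308635795668227/419430400000000 * x ^ 3 * y ^ 7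
         + 34047533351024817/52428800000000 * x ^ 4 * y ^ 6
         + 2090790936755469/1310720000000 * x ^ 5 * y ^ 5
         + 38598487459113/16384000000 * x ^ 6 * y ^ 4 + 87062209779/40960000 * x ^ 7 * y ^ 3
         + 23209131429/20480000 * x ^ 8 * y ^ 2 + 20785957/64000 * x ^ 9 * y ^ 1
         + 3949/100 * x ^ 10 * y ^ 0 := by
      subst hx hy
      rw [residual]
      ring
    have pos : 0 ≤ (2015993900449/10485760000000000) * (residual t - 101/100) := by
      rw [key]; positivity
    linarith [nonneg_of_mul_nonneg_right pos (by norm_num)]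
  rcases le_total t (9/40) with h | h
  · exact h2 (by linarith) h
  rcases le_total t (23/40) with h' | h'
  · exact h3 h h'
  · exact h4 h' (by linarith)

noncomputable def pP11 : ℝ[X] :=
  pA * pD pF ^ 2 + pB * pF ^ 2 + C (5/4) * pY * pF - C (1/4) * pW ^ 3 * pLh ^ 2

noncomputable def pM11 : ℝ[X] :=
  C (-755483/2560000) * X + C (198015923/23040000) * X ^ 3 + C (-4268197961/38400000) * X ^ 5
   + C (2428079541/2560000) * X ^ 7 + C (-383469955483/69120000) * X ^ 9
   + C (399161874697/16896000) * X ^ 11 + C (-637678303277/8320000) * X ^ 13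
   + C (11219324348383/57600000) * X ^ 15 + C (-4272799287123/10880000) * X ^ 17
   + C (3825032880267/6080000) * X ^ 19 + C (-7111678792437/8960000) * X ^ 21
   + C (11357661764583/14720000) * X ^ 23 + C (-1776717159021/3200000) * X ^ 25
   + C (35381059659/128000) * X ^ 27 + C (-250277299119/2969600) * X ^ 29
   + C (37357653843/3174400) * X ^ 31

theorem eval_pD_pM11 (x : ℝ) : (pD pM11).eval x = pP11.eval x := by
  simp [pP11, pM11, pLh, pB, pA, pY, pF, pG, pV, pQ, pD, pPsi, pW, derivative_pow]
  ring

noncomputable def pP12 : ℝ[X] := C (1/2) * pW ^ 3 * pLh * pRh - pF * pR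

noncomputable def pM12 : ℝ[X] :=
  C (27189/32000) * X + C (-538361/24000) * X ^ 3 + C (11821077/32000) * X ^ 5
   + C (-771583507/224000) * X ^ 7 + C (5880064301/288000) * X ^ 9
   + C (-235169277/2816) * X ^ 11 + C (103477401163/416000) * X ^ 13
   + C (-44573896761/80000) * X ^ 15 + C (517261891191/544000) * X ^ 17
   + C (-374054504751/304000) * X ^ 19 + C (52978781673/44800) * X ^ 21
   + C (-23939651007/29440) * X ^ 23 + C (60169889259/160000) * X ^ 25
   + C (-133515927/1280) * X ^ 27 + C (485086077/37120) * X ^ 29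

theorem eval_pD_pM12 (x : ℝ) : (pD pM12).eval x = pP12.eval x := by
  simp [pP12, pM12, pLh, pRh, pR, pY, pF, pV, pQ, pD, pW, derivative_pow]
  ring

noncomputable def pP22 : ℝ[X] := -C (1/4) * pW ^ 3 * pRh ^ 2

noncomputable def pM22 : ℝ[X] :=
  C (-2187/1600) * X + C (8937/320) * X ^ 3 + C (-1597587/4000) * X ^ 5
   + C (19549743/5600) * X ^ 7 + C (-94277587/4800) * X ^ 9 + C (1310628189/17600) * X ^ 11
   + C (-204125541/1040) * X ^ 13 + C (732372511/2000) * X ^ 15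
   + C (-529390629/1088) * X ^ 17 + C (2781216909/6080) * X ^ 19
   + C (-332969013/1120) * X ^ 21 + C (93520143/736) * X ^ 23 + C (-51420663/1600) * X ^ 25
   + C (233289/64) * X ^ 27

theorem eval_pD_pM22 (x : ℝ) : (pD pM22).eval x = pP22.eval x := by
  simp [pP22, pM22, pRh, pD, pW, derivative_pow]
  ring

theorem quadratic_form_lower (k z : ℝ) :
    1/100 * (k ^ 2 + z ^ 2) ≤ k ^ 2 * (pM11.eval 1 - pM11.eval (-1))
      + k * z * (pM12.eval 1 - pM12.eval (-1) - 5/4)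
      + z ^ 2 * (pM22.eval 1 - pM22.eval (-1) + 6/5) := by
  simp only [pM11, pM12, pM22, eval_add, eval_mul, eval_C, eval_X, eval_pow]
  norm_num
  nlinarith [sq_nonneg (k - 8/5 * z), sq_nonneg k, sq_nonneg z]

theorem eval_pW (x : ℝ) : pW.eval x = 1 - x ^ 2 := by simp [pW]

theorem pW_pow_dvd_pD {A : ℝ[X]} {k : ℕ} (h : pW ^ k ∣ A) : pW ^ (k + 1) ∣ pD A := by
  obtain ⟨B, rfl⟩ := h
  rcases k with _ | k
  · exact ⟨C (3/4) * pW * derivative (pW ^ 0 * B), by rw [pD]; ring⟩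
  · refine ⟨C (3/4) * (((k + 1 : ℕ) : ℝ[X]) * derivative pW * B + pW * derivative B), ?_⟩
    rw [pD, derivative_mul, derivative_pow_succ]
    push_cast
    simp only [map_add, map_natCast, map_one]
    ring

theorem pW_sq_dvd_pD (A : ℝ[X]) : pW ^ 2 ∣ pD A := ⟨C (3/4) * derivative A, by rw [pD]; ring⟩

theorem exists_bound_of_dvd {A : ℝ[X]} {k : ℕ} (hA : pW ^ k ∣ A) :
    ∃ K : ℝ, 0 ≤ K ∧ ∀ h : ℝ, |h| < 1 → |A.eval h| ≤ K * (1 - h ^ 2) ^ k := by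
  obtain ⟨B, rfl⟩ := hA
  obtain ⟨K, hK⟩ := isCompact_Icc.exists_bound_of_continuousOn (s := Set.Icc (-1 : ℝ) 1)
    (f := fun h => B.eval h) B.continuous.continuousOn
  refine ⟨K, (norm_nonneg _).trans (hK 0 (by norm_num)), fun h hh => ?_⟩
  have h1 := abs_lt.1 hh
  have h2 : 0 ≤ 1 - h ^ 2 := by nlinarith
  rw [eval_mul, eval_pow, eval_pW, abs_mul, abs_of_nonneg (pow_nonneg h2 k), mul_comm]
  exact mul_le_mul_of_nonneg_right (hK h ⟨h1.1.le, h1.2.le⟩) (pow_nonneg h2 k)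

theorem exists_common_bound (l : List (ℝ[X] × ℕ)) (hl : ∀ p ∈ l, pW ^ p.2 ∣ p.1) :
    ∃ K : ℝ, 1 ≤ K ∧ ∀ p ∈ l, ∀ h : ℝ, |h| < 1 → |p.1.eval h| ≤ K * (1 - h ^ 2) ^ p.2 := by
  induction l with
  | nil => exact ⟨1, le_rfl, by simp⟩
  | cons a l ih =>
    obtain ⟨K, hK1, hK⟩ := ih fun p hp => hl p (List.mem_cons_of_mem _ hp)
    obtain ⟨K', hK0', hK'⟩ := exists_bound_of_dvd (hl a List.mem_cons_self)
    refine ⟨K + K', by linarith, fun p hp h hh => ?_⟩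
    have h1 := abs_lt.1 hh
    have h2 : 0 ≤ (1 - h ^ 2) ^ p.2 := pow_nonneg (by nlinarith) _
    rcases List.mem_cons.1 hp with rfl | hp
    · exact (hK' h hh).trans (mul_le_mul_of_nonneg_right (by linarith) h2)
    · exact (hK p hp h hh).trans (mul_le_mul_of_nonneg_right (by linarith) h2)

theorem dvd_pV : pW ^ 2 ∣ pV := ⟨C (9/2) * (1 - pQ), by
  rw [pV, pQ, show (C (9/2 : ℝ)) = 2 * C (3/2) ^ 2 by
    rw [← C_pow, ← C_ofNat, ← C_mul]; norm_num]; ring⟩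

theorem dvd_pG : pW ^ 2 ∣ pG := (pW_sq_dvd_pD _).mul_left _
theorem dvd_pA : pW ^ 2 ∣ pA := (pW_sq_dvd_pD _).mul_left _
theorem dvd_pY : pW ^ 4 ∣ pY := dvd_mul_right _ _
theorem dvd_pF : pW ^ 1 ∣ pF := by rw [pow_one]; exact dvd_mul_right _ _
theorem dvd_pQ : pW ^ 1 ∣ pQ := by rw [pow_one]; exact dvd_mul_left _ _

theorem dvd_of_le {A : ℝ[X]} {j k : ℕ} (hjk : j ≤ k) (h : pW ^ k ∣ A) : pW ^ j ∣ A :=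
  (pow_dvd_pow _ hjk).trans h

theorem dvd_mul' {A B : ℝ[X]} {i j k : ℕ} (hk : k ≤ i + j) (hA : pW ^ i ∣ A) (hB : pW ^ j ∣ B) :
    pW ^ k ∣ A * B :=
  dvd_of_le hk (by rw [pow_add]; exact mul_dvd_mul hA hB)

theorem dvd_pB : pW ^ 3 ∣ pB := by
  refine dvd_sub (dvd_sub (dvd_mul' (by norm_num) (?_ : pW ^ 2 ∣ _) dvd_pV)
    ((pW_pow_dvd_pD dvd_pV).mul_left _)) (dvd_of_le (by norm_num)
      ((pW_pow_dvd_pD (pW_pow_dvd_pD dvd_pG)).mul_left _))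
  exact (dvd_sub dvd_pG (pW_sq_dvd_pD _)).mul_left _

theorem dvd_pR : pW ^ 4 ∣ pR := by
  refine dvd_add (dvd_sub (dvd_pY.mul_left _) ?_) (dvd_pY.mul_left _)
  exact dvd_of_le (by norm_num) (pW_pow_dvd_pD (pW_pow_dvd_pD dvd_pY))

theorem dvd_pD_pF : pW ^ 2 ∣ pD pF := pW_sq_dvd_pD _

theorem dvd_pD_pA_pD_pF : pW ^ 5 ∣ pD (pA * pD pF) :=
  pW_pow_dvd_pD (dvd_mul' le_rfl dvd_pA dvd_pD_pF)

theorem dvd_pA_pD_pF_sq : pW ^ 6 ∣ pA * pD pF ^ 2 :=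
  dvd_mul' (j := 4) le_rfl dvd_pA (by
    rw [show (4 : ℕ) = 2 * 2 by norm_num, pow_mul]; exact pow_dvd_pow_of_dvd dvd_pD_pF 2)

theorem dvd_pP11 : pW ^ 3 ∣ pP11 := by
  refine dvd_sub (dvd_add (dvd_add (dvd_of_le (by norm_num) dvd_pA_pD_pF_sq)
    (dvd_pB.mul_right _)) ?_) ((dvd_mul_left _ _).mul_right _)
  exact (dvd_of_le (by norm_num) (dvd_pY.mul_left _)).mul_right _

theorem dvd_pP12 : pW ^ 3 ∣ pP12 :=
  dvd_sub (((dvd_mul_left _ _).mul_right _).mul_right _)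
    (dvd_of_le (by norm_num) (dvd_pR.mul_left _))

theorem dvd_pP22 : pW ^ 3 ∣ pP22 := (dvd_mul_left _ _).mul_right _

/-- The coefficient of `u ^ 2` in the nonlinear virial density. -/
noncomputable def Fc (h u : ℝ) : ℝ :=
  -(1/4) * (pD (pD pG)).eval h
    + (pD pPsi).eval h * (-(1/4) * (pQ.eval h) ^ 2 * (2 * h + u) ^ 2 + (pQ.eval h) ^ 3 / 3)
    + (1/2) * pG.eval h * ((pQ.eval h) ^ 2 * (2 * h + u) ^ 2 / 2
        + (pQ.eval h) ^ 2 * u * (2 * h + u) / 2 - 2 * (pQ.eval h) ^ 3 / 3)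
    + pPsi.eval h * ((1/2) * (pQ.eval h) ^ 3 * h * (2 * h + u) ^ 2
        - (pQ.eval h) ^ 4 * (2 * h + u) / 3 - (pQ.eval h) ^ 4 * h)

noncomputable def pF0 : ℝ[X] := -C (1/4) * pD (pD pG) - X * pPsi * pQ ^ 4

theorem eval_pF0_sub_pE (x : ℝ) : pF0.eval x - pE.eval x = (1 - x ^ 2) ^ 4 * (1701/1600
    + (1 - x ^ 2) * (C (13851/3200) + C (-400059/6400) * X ^ 2 + C (4882761/12800) * X ^ 4
      + C (-15069159/12800) * X ^ 6 + C (4373271/1600) * X ^ 8 + C (-53933607/12800) * X ^ 10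
      + C (11170467/3200) * X ^ 12 + C (-352107/100) * X ^ 14
      + C (10206/5) * X ^ 16 : ℝ[X]).eval x) := by
  simp [pF0, pE, pRes, pB, pG, pV, pQ, pD, pPsi, pW, derivative_pow]
  ring

theorem Fc_near : ∃ K : ℝ, 0 ≤ K ∧ ∀ h u : ℝ, |h| < 1 →
    pB.eval h - K * |u| * (1 - h ^ 2) ^ 3 ≤ Fc h u := by
  obtain ⟨K, hK0, hK⟩ := exists_bound_of_dvd (k := 3)
    (A := pD pPsi * pQ ^ 2 * X * C (7/20) + pPsi * (2 * pQ ^ 3 * X ^ 2 - C (1/3) * pQ ^ 4)) (by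
      have h2 : pW ^ 2 ∣ pQ ^ 2 := by simpa using pow_dvd_pow_of_dvd dvd_pQ 2
      have h3 : pW ^ 3 ∣ pQ ^ 3 := by simpa using pow_dvd_pow_of_dvd dvd_pQ 3
      have h4 : pW ^ 4 ∣ pQ ^ 4 := by simpa using pow_dvd_pow_of_dvd dvd_pQ 4
      refine dvd_add (((dvd_mul' (by norm_num) (pW_sq_dvd_pD _) h2).mul_right _).mul_right _) ?_
      exact (dvd_sub ((h3.mul_left _).mul_right _)
        (dvd_of_le (by norm_num) (h4.mul_left _))).mul_left _)
  refine ⟨K, hK0, fun h u hh => ?_⟩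
  have h1 := abs_lt.1 hh
  have h2 : 0 ≤ 1 - h ^ 2 := by nlinarith
  have key := hK h hh
  have hd : 0 ≤ (pD pPsi).eval h := by
    simp [pD, pPsi, pW, derivative_pow]; positivity
  have hp : 0 ≤ pPsi.eval h * h := by
    have : pPsi.eval h * h = h ^ 2 + h ^ 4 + 4 * h ^ 6 := by simp [pPsi]; ring
    rw [this]; positivity
  have hq : 0 ≤ pQ.eval h := by simp [pQ, eval_pW]; linarith
  have e : Fc h u = pB.eval h + u * (pD pPsi * pQ ^ 2 * X * C (7/20)
      + pPsi * (2 * pQ ^ 3 * X ^ 2 - C (1/3) * pQ ^ 4)).eval h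
      + u ^ 2 * ((pD pPsi).eval h * pQ.eval h ^ 2 * (1/5)
        + 1/2 * (pPsi.eval h * h) * pQ.eval h ^ 3) := by
    simp [Fc, pB, pV, pQ, pG, pD, pPsi, pW, derivative_pow]
    ring
  rw [e]
  have b1 : -(|u| * (K * (1 - h ^ 2) ^ 3)) ≤ u * (pD pPsi * pQ ^ 2 * X * C (7/20)
      + pPsi * (2 * pQ ^ 3 * X ^ 2 - C (1/3) * pQ ^ 4)).eval h := by
    refine (neg_le_neg ?_).trans (neg_abs_le _)
    rw [abs_mul]
    exact mul_le_mul_of_nonneg_left key (abs_nonneg _)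
  have b2 : 0 ≤ u ^ 2 * ((pD pPsi).eval h * pQ.eval h ^ 2 * (1/5)
        + 1/2 * (pPsi.eval h * h) * pQ.eval h ^ 3) := by positivity
  linarith

theorem Fc_far : ∃ K : ℝ, 0 ≤ K ∧ ∀ h u : ℝ, |h| < 1 → 1/4 ≤ h ^ 2 →
    pF0.eval h - K * (1 - h ^ 2) ^ 5 ≤ Fc h u := by
  obtain ⟨K, hK0, hK⟩ := exists_bound_of_dvd (k := 4)
    (A := C (9/20) * pD pPsi * pQ ^ 2 * X + C (1/3) * pPsi * pQ ^ 4) (by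
      have h2 : pW ^ 2 ∣ pQ ^ 2 := by simpa using pow_dvd_pow_of_dvd dvd_pQ 2
      have h4 : pW ^ 4 ∣ pQ ^ 4 := by simpa using pow_dvd_pow_of_dvd dvd_pQ 4
      exact dvd_add ((dvd_mul' (by norm_num) ((pW_sq_dvd_pD _).mul_left _) h2).mul_right _)
        (h4.mul_left _))
  refine ⟨K ^ 2, by positivity, fun h u hh hh2 => ?_⟩
  have h1 := abs_lt.1 hh
  have h2 : 0 ≤ 1 - h ^ 2 := by nlinarith
  have key := hK h hh
  have hd : 0 ≤ (pD pPsi).eval h := by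
    simp [pD, pPsi, pW, derivative_pow]; positivity
  have hp : 1/4 ≤ pPsi.eval h * h := by
    have : pPsi.eval h * h = h ^ 2 + h ^ 4 + 4 * h ^ 6 := by simp [pPsi]; ring
    rw [this]
    have : 0 ≤ h ^ 4 + 4 * h ^ 6 := by positivity
    linarith
  have e : Fc h u = pF0.eval h - (2 * h + u) * (C (9/20) * pD pPsi * pQ ^ 2 * X
      + C (1/3) * pPsi * pQ ^ 4).eval h
      + (pD pPsi).eval h * (pQ.eval h ^ 2 * (2 * h + u) ^ 2 * (1/5) + 9/80 * (1 - h ^ 2) ^ 3)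
        + 27/16 * (pPsi.eval h * h) * (1 - h ^ 2) ^ 3 * (2 * h + u) ^ 2 := by
    simp [Fc, pF0, pQ, pG, pD, pPsi, pW, derivative_pow]
    ring
  rw [e]
  set s := 2 * h + u
  set w := 1 - h ^ 2
  set A := (C (9/20) * pD pPsi * pQ ^ 2 * X + C (1/3) * pPsi * pQ ^ 4 : ℝ[X]).eval h
  have b1 : s * A ≤ |s| * (K * w ^ 4) := by
    refine (le_abs_self _).trans ?_
    rw [abs_mul]
    exact mul_le_mul_of_nonneg_left key (abs_nonneg _)
  have b2 : 0 ≤ (pD pPsi).eval h * (pQ.eval h ^ 2 * s ^ 2 * (1/5) + 9/80 * w ^ 3) := by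
    positivity
  have b3 : 27/64 * w ^ 3 * s ^ 2 ≤ 27/16 * (pPsi.eval h * h) * w ^ 3 * s ^ 2 := by
    have : 0 ≤ w ^ 3 * s ^ 2 := by positivity
    nlinarith
  have b4 : |s| * (K * w ^ 4) ≤ 27/64 * w ^ 3 * s ^ 2 + K ^ 2 * w ^ 5 := by
    rw [← sq_abs s]
    have : 0 ≤ w ^ 3 * (1/2 * |s| - K * w) ^ 2 + 11/64 * w ^ 3 * |s| ^ 2 := by positivity
    nlinarith
  linarith

/-- The nonlinearity of the equation for the perturbation `u` of the profile value `h`. -/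
noncomputable def Gu (h u : ℝ) : ℝ :=
  (3/2 * (1 - h ^ 2)) ^ 2 * ((h + u) ^ 3 - (h + u) - h ^ 3 + h)

noncomputable def staticDensity (h κ z v : ℝ) : ℝ :=
  -pE.eval h * v ^ 2 + κ ^ 2 * (pA * pD pF ^ 2).eval h - 2 * κ * (pD (pA * pD pF)).eval h * v
    + Fc h (κ * pF.eval h + v) * (κ * pF.eval h + v) ^ 2
    + z * ((pD (pD pY)).eval h * (κ * pF.eval h + v) - pY.eval h * Gu h (κ * pF.eval h + v))
    - 6/5 * z * (pY.eval h * (κ * pF.eval h + v)) + 5/4 * κ * (pY.eval h * (κ * pF.eval h + v))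

theorem cubic_term_bound {w z Y h u K ε : ℝ} (hw0 : 0 ≤ w) (hw1 : w ≤ 1) (hh : |h| ≤ 1)
    (hY : |Y| ≤ K * w ^ 4) (hz : |z| ≤ ε) (hε : ε ≤ 1) (hu : w * u ^ 2 ≤ ε ^ 2) :
    z * (Y * (9/4 * w ^ 2 * (3 * h * u ^ 2 + u ^ 3))) ≤ 9 * K * ε * (w ^ 5 * u ^ 2) := by
  have hε0 : 0 ≤ ε := (abs_nonneg _).trans hz
  have hwu : |w * u| ≤ 1 := by
    rw [← sq_le_one_iff_abs_le_one]
    nlinarith [mul_nonneg hw0 (sq_nonneg u), mul_nonneg (sub_nonneg.2 hw1)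
      (mul_nonneg hw0 (sq_nonneg u))]
  have h1 : |w * (3 * h + u)| ≤ 4 := by
    have : |3 * (w * h)| ≤ 3 := by
      rw [abs_mul, abs_mul, abs_of_nonneg hw0]
      have := mul_le_one₀ hw1 (abs_nonneg h) hh
      norm_num; linarith
    calc |w * (3 * h + u)| = |3 * (w * h) + w * u| := by ring_nf
      _ ≤ _ := (abs_add_le _ _).trans (by linarith)
  have h2 : |z * Y| ≤ ε * (K * w ^ 4) := by
    rw [abs_mul]; exact mul_le_mul hz hY (abs_nonneg _) hε0
  have h3 : |(z * Y) * (w * (3 * h + u))| ≤ ε * (K * w ^ 4) * 4 := by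
    rw [abs_mul]; exact mul_le_mul h2 h1 (abs_nonneg _) ((abs_nonneg _).trans h2)
  have h4 := (le_abs_self _).trans h3
  have h5 : 0 ≤ 9/4 * (w * u ^ 2) := by positivity
  calc z * (Y * (9/4 * w ^ 2 * (3 * h * u ^ 2 + u ^ 3)))
      = (z * Y) * (w * (3 * h + u)) * (9/4 * (w * u ^ 2)) := by ring
    _ ≤ ε * (K * w ^ 4) * 4 * (9/4 * (w * u ^ 2)) := mul_le_mul_of_nonneg_right h4 h5
    _ = _ := by ring

theorem sq_le_of_eq_add {κ f v u M : ℝ} (hu : u = κ * f + v) (hf : |f| ≤ M) :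
    u ^ 2 ≤ 2 * v ^ 2 + 2 * (κ ^ 2 * M ^ 2) := by
  have hf2 : f ^ 2 ≤ M ^ 2 := by
    rw [← sq_abs f]; exact pow_le_pow_left₀ (abs_nonneg _) hf 2
  have := mul_le_mul_of_nonneg_left hf2 (sq_nonneg κ)
  calc u ^ 2 = 2 * v ^ 2 + 2 * (κ ^ 2 * f ^ 2) - (κ * f - v) ^ 2 := by rw [hu]; ring
    _ ≤ _ := by linarith [sq_nonneg (κ * f - v)]

theorem near_estimate {w ρ v κ f u K τ η X : ℝ} (hw0 : 0 ≤ w) (hw1 : w ≤ 1)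
    (hρ : 101/100 ≤ ρ) (hu : u = κ * f + v) (hf : |f| ≤ K * w) (hτ0 : 0 ≤ τ)
    (hτ1 : 400 * τ ≤ 1) (hτη : 4 * τ * K ^ 2 ≤ η) (hX : -(τ * (w ^ 3 * u ^ 2)) ≤ X) :
    τ * (w ^ 4 * u ^ 2) - η * (w ^ 2 * κ ^ 2) ≤ w ^ 3 * (ρ - 1) * v ^ 2 + X := by
  have hu2 := sq_le_of_eq_add hu hf
  have hw43 : w ^ 4 * u ^ 2 ≤ w ^ 3 * u ^ 2 :=
    mul_le_mul_of_nonneg_right (pow_le_pow_of_le_one hw0 hw1 (by norm_num)) (sq_nonneg u)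
  have h1 : w ^ 3 * u ^ 2 ≤ w ^ 3 * (2 * v ^ 2 + 2 * (κ ^ 2 * (K * w) ^ 2)) :=
    mul_le_mul_of_nonneg_left hu2 (by positivity)
  have h2 : 1/100 * (w ^ 3 * v ^ 2) ≤ w ^ 3 * (ρ - 1) * v ^ 2 := by
    have : 0 ≤ w ^ 3 * v ^ 2 := by positivity
    nlinarith
  have h3 : 4 * τ * (w ^ 3 * v ^ 2) ≤ 1/100 * (w ^ 3 * v ^ 2) :=
    mul_le_mul_of_nonneg_right (by linarith) (by positivity)
  have h4 : 4 * τ * K ^ 2 * (w ^ 5 * κ ^ 2) ≤ η * (w ^ 2 * κ ^ 2) := by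
    refine mul_le_mul hτη ?_ (by positivity) (le_trans (by positivity) hτη)
    exact mul_le_mul_of_nonneg_right (pow_le_pow_of_le_one hw0 hw1 (by norm_num)) (sq_nonneg κ)
  have h5 := mul_le_mul_of_nonneg_left h1 hτ0
  have h6 := mul_le_mul_of_nonneg_left hw43 hτ0
  linarith

theorem abs_mul_le_of_le {a b M : ℝ} (h : |b| ≤ M) : |a * b| ≤ |a| * M := by
  rw [abs_mul]; exact mul_le_mul_of_nonneg_left h (abs_nonneg _)

theorem abs_mul_abs_le (a b : ℝ) : |a| * |b| ≤ 1/2 * (a ^ 2 + b ^ 2) := by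
  rw [← sq_abs a, ← sq_abs b]; linarith [sq_nonneg (|a| - |b|)]

theorem weighted_cross_le {w K k v : ℝ} :
    |k| * |v| * (K * w ^ 4) ≤ w ^ 4 * (1/16 * v ^ 2 + 4 * K ^ 2 * k ^ 2) := by
  have : |k| * |v| * K ≤ 1/16 * v ^ 2 + 4 * K ^ 2 * k ^ 2 := by
    rw [← sq_abs k, ← sq_abs v]
    linarith [sq_nonneg (|v| / 4 - 2 * (K * |k|))]
  calc _ = w ^ 4 * (|k| * |v| * K) := by ring
    _ ≤ _ := mul_le_mul_of_nonneg_left this (by positivity)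

theorem far_estimate {w e v κ z f u K c η L r Cf rf p11 p12 p22 X : ℝ} (hw0 : 0 ≤ w)
    (hw1 : 100 * K * w ≤ 1) (hK : 1 ≤ K) (hη : 20 * K ^ 2 * w ≤ η)
    (he : w ^ 4 * (1 - 2 * K * w) ≤ e) (hu : u = κ * f + v) (hf : |f| ≤ K * w)
    (hL : |L| ≤ K * w ^ 4) (hr : |r| ≤ K * w ^ 4) (hCf : |Cf| ≤ K * w ^ 3)
    (hrf : |rf| ≤ K * w ^ 3) (h11 : |p11| ≤ K * w ^ 3) (h12 : |p12| ≤ K * w ^ 3)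
    (h22 : |p22| ≤ K * w ^ 3) (hc : 20 * c ≤ 1)
    (hX : -(9 * K * (w ^ 5 * u ^ 2)) ≤ X) :
    κ ^ 2 * p11 + κ * z * p12 + z ^ 2 * p22 - η * w ^ 2 * (κ ^ 2 + z ^ 2) + c * (w ^ 4 * u ^ 2) ≤
      e * v ^ 2 + κ * v * L - z * v * r + κ ^ 2 * Cf - κ * z * rf + X := by
  have hKw : w ≤ 1/100 := by
    have := mul_le_mul_of_nonneg_right hK hw0
    linarith
  have hu4 : w ^ 4 * u ^ 2 ≤ w ^ 4 * (2 * v ^ 2 + 2 * (κ ^ 2 * (K * w) ^ 2)) :=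
    mul_le_mul_of_nonneg_left (sq_le_of_eq_add hu hf) (by positivity)
  have b1 := neg_le_of_abs_le (abs_mul_le_of_le (a := κ * v) hL)
  have b2 := le_of_abs_le (abs_mul_le_of_le (a := z * v) hr)
  have b3 := neg_le_of_abs_le (abs_mul_le_of_le (a := κ ^ 2) hCf)
  have b4 := le_of_abs_le (abs_mul_le_of_le (a := κ * z) hrf)
  have b5 := le_of_abs_le (abs_mul_le_of_le (a := κ ^ 2) h11)
  have b6 := le_of_abs_le (abs_mul_le_of_le (a := κ * z) h12)
  have b7 := le_of_abs_le (abs_mul_le_of_le (a := z ^ 2) h22)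
  rw [abs_of_nonneg (sq_nonneg κ)] at b3 b5
  rw [abs_of_nonneg (sq_nonneg z)] at b7
  rw [abs_mul] at b1 b2 b4 b6
  have w3 : 0 ≤ K * w ^ 3 := by positivity
  have y1 := mul_le_mul_of_nonneg_right (abs_mul_abs_le κ z) w3
  have y3 := weighted_cross_le (w := w) (K := K) (k := κ) (v := v)
  have y4 := weighted_cross_le (w := w) (K := K) (k := z) (v := v)
  have he2 : w ^ 4 * (49/50) * v ^ 2 ≤ e * v ^ 2 :=
    mul_le_mul_of_nonneg_right (le_trans (mul_le_mul_of_nonneg_left (by linarith)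
      (by positivity)) he) (sq_nonneg v)
  have hX2 : 100 * K * w * (w ^ 4 * u ^ 2) ≤ 1 * (w ^ 4 * u ^ 2) :=
    mul_le_mul_of_nonneg_right hw1 (by positivity)
  have hc2 : 20 * c * (w ^ 4 * u ^ 2) ≤ 1 * (w ^ 4 * u ^ 2) :=
    mul_le_mul_of_nonneg_right hc (by positivity)
  have hη2 := mul_le_mul_of_nonneg_right hη (show 0 ≤ w ^ 2 * (κ ^ 2 + z ^ 2) by positivity)
  have t1 : K * (w ^ 3 * (κ ^ 2 + z ^ 2)) ≤ K ^ 2 * (w ^ 3 * (κ ^ 2 + z ^ 2)) :=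
    mul_le_mul_of_nonneg_right (le_self_pow₀ hK (by norm_num)) (by positivity)
  have t2 : w * (K ^ 2 * (w ^ 3 * (κ ^ 2 + z ^ 2))) ≤ 1/100 * (K ^ 2 * (w ^ 3 * (κ ^ 2 + z ^ 2))) :=
    mul_le_mul_of_nonneg_right hKw (by positivity)
  have t3 : w ^ 3 * (K ^ 2 * (w ^ 3 * κ ^ 2)) ≤ 1 * (K ^ 2 * (w ^ 3 * κ ^ 2)) :=
    mul_le_mul_of_nonneg_right (pow_le_one₀ hw0 (by linarith)) (by positivity)
  have t4 : 0 ≤ w ^ 4 * v ^ 2 := by positivity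
  have t5 : 0 ≤ K ^ 2 * (w ^ 3 * z ^ 2) := by positivity
  have t6 : 0 ≤ K ^ 2 * (w ^ 3 * κ ^ 2) := by positivity
  have t7 : 0 ≤ K * w ^ 3 * z ^ 2 := by positivity
  linarith

theorem staticDensity_eq (h κ z v β : ℝ) : staticDensity h κ z v =
    (β - pE.eval h) * v ^ 2
      + κ * v * (2 * (β * pF.eval h - (pD (pA * pD pF)).eval h) + 5/4 * pY.eval h)
      - z * v * pR.eval h
      + κ ^ 2 * ((pA * pD pF ^ 2).eval h + β * pF.eval h ^ 2 + 5/4 * pY.eval h * pF.eval h)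
      - κ * z * (pF.eval h * pR.eval h)
      + ((Fc h (κ * pF.eval h + v) - β) * (κ * pF.eval h + v) ^ 2
        - z * (pY.eval h * (9/4 * (1 - h ^ 2) ^ 2 *
          (3 * h * (κ * pF.eval h + v) ^ 2 + (κ * pF.eval h + v) ^ 3)))) := by
  have hR : pR.eval h = pV.eval h * pY.eval h - (pD (pD pY)).eval h + 6/5 * pY.eval h := by
    simp [pR]
  have hGu (u : ℝ) : Gu h u = pV.eval h * u + 9/4 * (1 - h ^ 2) ^ 2 * (3 * h * u ^ 2 + u ^ 3) := by
    simp [Gu, pV, pQ, pW]; ring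
  rw [staticDensity, hGu, hR]
  ring

theorem static_near {h κ z v u K K₁ η τ ε w₁ : ℝ} (hh : |h| < 1) (hu : u = κ * pF.eval h + v)
    (hK : 1 ≤ K) (hK₁ : K₁ + 1 ≤ K)
    (near : pB.eval h - K₁ * |u| * (1 - h ^ 2) ^ 3 ≤ Fc h u)
    (hF : |pF.eval h| ≤ K * (1 - h ^ 2)) (hτ0 : 0 ≤ τ) (hτa : 400 * τ ≤ 1)
    (hτb : 4 * τ * K ^ 2 ≤ η) (hε0 : 0 ≤ ε) (hε : 10 * K * ε = τ) (hw₁0 : 0 < w₁) (hw₁1 : w₁ ≤ 1)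
    (hcase : w₁ ≤ 1 - h ^ 2) (husm : (1 - h ^ 2) * u ^ 2 ≤ (ε * w₁) ^ 2)
    (hcub : z * (pY.eval h * (9/4 * (1 - h ^ 2) ^ 2 * (3 * h * u ^ 2 + u ^ 3))) ≤
      9 * K * (ε * w₁) * ((1 - h ^ 2) ^ 5 * u ^ 2)) :
    κ ^ 2 * pP11.eval h + κ * z * pP12.eval h + z ^ 2 * pP22.eval h
      - η * (1 - h ^ 2) ^ 2 * (κ ^ 2 + z ^ 2)
      + τ * ((1 - h ^ 2) ^ 4 * u ^ 2) ≤ staticDensity h κ z v := by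
  have hhb := abs_lt.1 hh
  have hw0 : 0 < 1 - h ^ 2 := by nlinarith
  have hw1 : 1 - h ^ 2 ≤ 1 := by linarith [sq_nonneg h]
  have hη : 0 ≤ η := le_trans (by positivity) hτb
  have hres : 101/100 ≤ pRes.eval h := by
    refine (le_residual (sq_nonneg h) (by linarith)).trans (le_of_eq ?_)
    simp [pRes, residual]; ring
  have hEB : pE.eval h = pB.eval h - (1 - h ^ 2) ^ 3 * pRes.eval h := by
    simp [pE, eval_pW]
  have hL := eval_pL h
  have hR := eval_pR h
  have hLdef : pL.eval h = 2 * (pB.eval h * pF.eval h - (pD (pA * pD pF)).eval h)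
      + 5/4 * pY.eval h := by simp [pL, pBf]
  have hu1 : |u| ≤ ε := by
    refine abs_le_of_sq_le_sq ?_ hε0
    have : w₁ * u ^ 2 ≤ w₁ * ε ^ 2 := by
      calc w₁ * u ^ 2 ≤ (1 - h ^ 2) * u ^ 2 :=
            mul_le_mul_of_nonneg_right hcase (sq_nonneg u)
        _ ≤ (ε * w₁) ^ 2 := husm
        _ = w₁ * ε ^ 2 * w₁ := by ring
        _ ≤ w₁ * ε ^ 2 * 1 := mul_le_mul_of_nonneg_left hw₁1 (by positivity)
        _ = _ := by ring
    exact le_of_mul_le_mul_left this hw₁0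
  obtain ⟨N, hN⟩ : ∃ N, N = z * (pY.eval h * (9/4 * (1 - h ^ 2) ^ 2 *
    (3 * h * u ^ 2 + u ^ 3))) := ⟨_, rfl⟩
  have hX : -(τ * ((1 - h ^ 2) ^ 3 * u ^ 2)) ≤ (Fc h u - pB.eval h) * u ^ 2 - N := by
    rw [← hN] at hcub
    have hP : 0 ≤ (1 - h ^ 2) ^ 3 * u ^ 2 := by positivity
    have n2 : K₁ * |u| * ((1 - h ^ 2) ^ 3 * u ^ 2) ≤ K * ε * ((1 - h ^ 2) ^ 3 * u ^ 2) :=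
      mul_le_mul_of_nonneg_right (mul_le_mul (by linarith) hu1 (abs_nonneg _) (by linarith)) hP
    have n3 := mul_le_mul_of_nonneg_right near (sq_nonneg u)
    have n4 : 9 * K * (ε * w₁) * ((1 - h ^ 2) ^ 5 * u ^ 2) ≤
        9 * K * (ε * 1) * ((1 - h ^ 2) ^ 3 * u ^ 2) := by
      refine mul_le_mul (by gcongr) ?_ (by positivity) (by positivity)
      exact mul_le_mul_of_nonneg_right (pow_le_pow_of_le_one hw0.le hw1 (by norm_num))
        (sq_nonneg u)
    rw [← hε]
    linarith
  have key := near_estimate hw0.le hw1 hres hu hF hτ0 hτa hτb hX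
  have hηz : 0 ≤ η * ((1 - h ^ 2) ^ 2 * z ^ 2) := by positivity
  have hsq : 0 ≤ (1 - h ^ 2) ^ 3 * (v + 1/2 * (κ * pLh.eval h - z * pRh.eval h)) ^ 2 := by
    positivity
  have e : staticDensity h κ z v = (κ ^ 2 * pP11.eval h + κ * z * pP12.eval h
      + z ^ 2 * pP22.eval h) + ((1 - h ^ 2) ^ 3 * (pRes.eval h - 1) * v ^ 2
      + ((Fc h u - pB.eval h) * u ^ 2 - N))
      + (1 - h ^ 2) ^ 3 * (v + 1/2 * (κ * pLh.eval h - z * pRh.eval h)) ^ 2 := by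
    rw [staticDensity_eq h κ z v (pB.eval h), ← hu, ← hN, hEB, pP11, pP12, pP22]
    rw [hLdef] at hL
    simp only [eval_add, eval_sub, eval_mul, eval_neg, eval_C, eval_pow, eval_pW]
    linear_combination (κ * v) * hL - (z * v) * hR
  rw [e]
  linarith

theorem dvd_Fc_far (K : ℝ) : pW ^ 4 ∣ pF0 - C K * pW ^ 5 := by
  have h4 : pW ^ 4 ∣ pQ ^ 4 := by simpa using pow_dvd_pow_of_dvd dvd_pQ 4
  rw [pF0]
  exact dvd_sub (dvd_sub ((pW_pow_dvd_pD (pW_pow_dvd_pD dvd_pG)).mul_left _)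
    (h4.mul_left _)) (dvd_of_le (by norm_num) (dvd_mul_left _ _))

theorem static_far_bounds {P : ℝ[X]} (hP : pW ^ 4 ∣ P) : ∃ K : ℝ, 1 ≤ K ∧ ∀ h : ℝ, |h| < 1 →
    |pY.eval h| ≤ K * (1 - h ^ 2) ^ 4 ∧ |pF.eval h| ≤ K * (1 - h ^ 2) ∧
    |2 * (P.eval h * pF.eval h - (pD (pA * pD pF)).eval h) + 5/4 * pY.eval h| ≤
      K * (1 - h ^ 2) ^ 4 ∧
    |pR.eval h| ≤ K * (1 - h ^ 2) ^ 4 ∧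
    |(pA * pD pF ^ 2).eval h + P.eval h * pF.eval h ^ 2 + 5/4 * pY.eval h * pF.eval h| ≤
      K * (1 - h ^ 2) ^ 3 ∧
    |pF.eval h * pR.eval h| ≤ K * (1 - h ^ 2) ^ 3 ∧
    |pP11.eval h| ≤ K * (1 - h ^ 2) ^ 3 ∧ |pP12.eval h| ≤ K * (1 - h ^ 2) ^ 3 ∧
    |pP22.eval h| ≤ K * (1 - h ^ 2) ^ 3 := by
  obtain ⟨K, hK1, hK⟩ := exists_common_bound
    [(pY, 4), (pF, 1), (2 * (P * pF - pD (pA * pD pF)) + C (5/4) * pY, 4), (pR, 4),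
      (pA * pD pF ^ 2 + P * pF ^ 2 + C (5/4) * pY * pF, 3), (pF * pR, 3),
      (pP11, 3), (pP12, 3), (pP22, 3)] (by
    simp only [List.forall_mem_cons, List.not_mem_nil, false_imp_iff, implies_true, and_true]
    refine ⟨dvd_pY, dvd_pF, ?_, dvd_pR, ?_, dvd_of_le (by norm_num) (dvd_pR.mul_left _),
      dvd_pP11, dvd_pP12, dvd_pP22⟩
    · exact dvd_add ((dvd_sub (hP.mul_right _)
        (dvd_of_le (by norm_num) dvd_pD_pA_pD_pF)).mul_left _) (dvd_pY.mul_left _)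
    · exact dvd_of_le (by norm_num : 3 ≤ 4) (dvd_add (dvd_add (dvd_of_le (by norm_num)
        dvd_pA_pD_pF_sq) (hP.mul_right _)) ((dvd_pY.mul_left _).mul_right _)))
  refine ⟨K, hK1, fun h hh => ?_⟩
  simpa only [List.forall_mem_cons, List.not_mem_nil, false_imp_iff, implies_true, and_true,
    forall_comm (α := ℝ × ℕ), pow_one, eval_add, eval_sub, eval_mul, eval_pow, eval_C,
    eval_ofNat] using fun p hp => hK p hp h hh

theorem static_far {h κ z v u K K₂ η c ε : ℝ} {P : ℝ[X]} (hh : |h| < 1)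
    (hu : u = κ * pF.eval h + v) (hK : 1 ≤ K)
    (hP : P = pF0 - C K₂ * pW ^ 5)
    (far : pF0.eval h - K₂ * (1 - h ^ 2) ^ 5 ≤ Fc h u)
    (hbd : |pY.eval h| ≤ K * (1 - h ^ 2) ^ 4 ∧ |pF.eval h| ≤ K * (1 - h ^ 2) ∧
      |2 * (P.eval h * pF.eval h - (pD (pA * pD pF)).eval h) + 5/4 * pY.eval h| ≤
        K * (1 - h ^ 2) ^ 4 ∧
      |pR.eval h| ≤ K * (1 - h ^ 2) ^ 4 ∧
      |(pA * pD pF ^ 2).eval h + P.eval h * pF.eval h ^ 2 + 5/4 * pY.eval h * pF.eval h| ≤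
        K * (1 - h ^ 2) ^ 3 ∧
      |pF.eval h * pR.eval h| ≤ K * (1 - h ^ 2) ^ 3 ∧
      |pP11.eval h| ≤ K * (1 - h ^ 2) ^ 3 ∧ |pP12.eval h| ≤ K * (1 - h ^ 2) ^ 3 ∧
      |pP22.eval h| ≤ K * (1 - h ^ 2) ^ 3)
    (hPE : (1 - h ^ 2) ^ 4 * (1 - 2 * K * (1 - h ^ 2)) ≤ P.eval h - pE.eval h)
    (hKw : 100 * K * (1 - h ^ 2) ≤ 1) (hη : 20 * K ^ 2 * (1 - h ^ 2) ≤ η)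
    (hc : 20 * c ≤ 1) (hε1 : ε ≤ 1)
    (hcub : z * (pY.eval h * (9/4 * (1 - h ^ 2) ^ 2 * (3 * h * u ^ 2 + u ^ 3))) ≤
      9 * K * ε * ((1 - h ^ 2) ^ 5 * u ^ 2)) :
    κ ^ 2 * pP11.eval h + κ * z * pP12.eval h + z ^ 2 * pP22.eval h
      - η * (1 - h ^ 2) ^ 2 * (κ ^ 2 + z ^ 2)
      + c * ((1 - h ^ 2) ^ 4 * u ^ 2) ≤ staticDensity h κ z v := by
  have hhb := abs_lt.1 hh
  have hw0 : 0 < 1 - h ^ 2 := by nlinarith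
  obtain ⟨-, bF, bL, bR, bC, bFR, b11, b12, b22⟩ := hbd
  obtain ⟨N, hN⟩ : ∃ N, N = z * (pY.eval h * (9/4 * (1 - h ^ 2) ^ 2 *
    (3 * h * u ^ 2 + u ^ 3))) := ⟨_, rfl⟩
  have hX : -(9 * K * ((1 - h ^ 2) ^ 5 * u ^ 2)) ≤ (Fc h u - P.eval h) * u ^ 2 - N := by
    rw [← hN] at hcub
    have n2 : 0 ≤ (Fc h u - P.eval h) * u ^ 2 := by
      refine mul_nonneg ?_ (sq_nonneg u)
      simp only [hP, eval_sub, eval_mul, eval_C, eval_pow, eval_pW]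
      linarith
    have n3 : 9 * K * ε * ((1 - h ^ 2) ^ 5 * u ^ 2) ≤
        9 * K * ((1 - h ^ 2) ^ 5 * u ^ 2) :=
      mul_le_mul_of_nonneg_right (mul_le_of_le_one_right (by linarith) hε1) (by positivity)
    linarith
  have key := far_estimate (z := z) hw0.le hKw hK hη hPE hu bF bL bR bC bFR b11 b12 b22 hc hX
  rw [staticDensity_eq h κ z v (P.eval h), ← hu, ← hN]
  exact key

theorem staticDensity_lower : ∀ η > 0, ∃ ε > 0, ∃ c > 0, ∀ h κ z v : ℝ, |h| < 1 →
    (1 - h ^ 2) * (κ * pF.eval h + v) ^ 2 ≤ ε ^ 2 → |z| ≤ ε →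
    κ ^ 2 * pP11.eval h + κ * z * pP12.eval h + z ^ 2 * pP22.eval h
      - η * (1 - h ^ 2) ^ 2 * (κ ^ 2 + z ^ 2)
      + c * ((1 - h ^ 2) ^ 4 * (κ * pF.eval h + v) ^ 2) ≤ staticDensity h κ z v := by
  intro η hη
  obtain ⟨K₁, hK₁, near⟩ := Fc_near
  obtain ⟨K₂, hK₂, far⟩ := Fc_far
  obtain ⟨K₃, hK₃, hbd⟩ := static_far_bounds (dvd_Fc_far K₂)
  obtain ⟨pq, hpq⟩ : ∃ q : ℝ[X], ∀ x, pF0.eval x - pE.eval x =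
      (1 - x ^ 2) ^ 4 * (1701/1600 + (1 - x ^ 2) * q.eval x) := ⟨_, eval_pF0_sub_pE⟩
  obtain ⟨K₄, hK₄, bq⟩ := exists_bound_of_dvd (A := pq) (k := 0) (by simp)
  obtain ⟨K, hKdef⟩ : ∃ K, K = K₁ + K₂ + K₃ + K₄ := ⟨_, rfl⟩
  have hK1 : 1 ≤ K := by linarith
  have up {x y : ℝ} (hy : 0 ≤ y) (hx : |x| ≤ K₃ * y) : |x| ≤ K * y :=
    hx.trans (mul_le_mul_of_nonneg_right (by linarith) hy)
  obtain ⟨w₁, hw₁0, hw₁a, hw₁b, hw₁c⟩ : ∃ w₁ : ℝ, 0 < w₁ ∧ 100 * K * w₁ ≤ 1 ∧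
      20 * K ^ 2 * w₁ ≤ η ∧ w₁ ≤ 1/100 := by
    refine ⟨min (1 / (100 * K)) (η / (20 * K ^ 2)), by positivity, ?_, ?_, ?_⟩
    · calc _ ≤ 100 * K * (1 / (100 * K)) :=
          mul_le_mul_of_nonneg_left (min_le_left _ _) (by positivity)
        _ = 1 := by field_simp
    · calc _ ≤ 20 * K ^ 2 * (η / (20 * K ^ 2)) :=
          mul_le_mul_of_nonneg_left (min_le_right _ _) (by positivity)
        _ = η := by field_simp
    · refine (min_le_left _ _).trans ?_
      rw [div_le_div_iff₀ (by positivity) (by norm_num)]; linarith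
  obtain ⟨τ, hτ0, hτa, hτb⟩ : ∃ τ : ℝ, 0 < τ ∧ 400 * τ ≤ 1 ∧ 4 * τ * K ^ 2 ≤ η := by
    refine ⟨min (1/400) (η / (4 * K ^ 2)), by positivity, ?_, ?_⟩
    · linarith [min_le_left (1/400) (η / (4 * K ^ 2))]
    · calc _ ≤ 4 * (η / (4 * K ^ 2)) * K ^ 2 := by
            gcongr; exact min_le_right _ _
        _ = η := by field_simp
  obtain ⟨ε₁, hε₁0, hε₁⟩ : ∃ ε₁ : ℝ, 0 < ε₁ ∧ 10 * K * ε₁ = τ :=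
    ⟨τ / (10 * K), by positivity, by field_simp⟩
  have hε₁1 : ε₁ ≤ 1 := by
    have := mul_le_mul_of_nonneg_right hK1 hε₁0.le
    linarith
  have hεw : ε₁ * w₁ ≤ ε₁ := mul_le_of_le_one_right hε₁0.le (by linarith)
  refine ⟨ε₁ * w₁, by positivity, τ, hτ0, fun h κ z v hh hu hz => ?_⟩
  have hhb := abs_lt.1 hh
  have hw0 : 0 < 1 - h ^ 2 := by nlinarith
  have hw1 : 1 - h ^ 2 ≤ 1 := by linarith [sq_nonneg h]
  obtain ⟨bY, bF, bL, bR, bC, bFR, b11, b12, b22⟩ := hbd h hh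
  have p4 : 0 ≤ (1 - h ^ 2) ^ 4 := by positivity
  have p3 : 0 ≤ (1 - h ^ 2) ^ 3 := by positivity
  have hcub := cubic_term_bound hw0.le hw1 hh.le (up p4 bY) hz (hεw.trans hε₁1) hu
  rcases le_total w₁ (1 - h ^ 2) with hcase | hcase
  · exact static_near hh rfl hK1 (by linarith) (near h _ hh) (up hw0.le bF) hτ0.le hτa hτb
      hε₁0.le hε₁ hw₁0 (by linarith) hcase hu hcub
  · refine static_far hh rfl hK1 rfl (far h _ hh (by linarith)) ⟨up p4 bY, up hw0.le bF, up p4 bL,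
      up p4 bR, up p3 bC, up p3 bFR, up p3 b11, up p3 b12, up p3 b22⟩ ?_
      (le_trans (mul_le_mul_of_nonneg_left hcase (by positivity)) hw₁a)
      (le_trans (mul_le_mul_of_nonneg_left hcase (by positivity)) hw₁b) (by linarith)
      (hεw.trans hε₁1) hcub
    have q0 := neg_le_of_abs_le (bq h hh)
    have : (pF0 - C K₂ * pW ^ 5).eval h - pE.eval h = (1 - h ^ 2) ^ 4 * (1701/1600
        + (1 - h ^ 2) * pq.eval h - K₂ * (1 - h ^ 2)) := by
      simp only [eval_sub, eval_mul, eval_C, eval_pow, eval_pW]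
      linear_combination hpq h
    rw [this]
    refine mul_le_mul_of_nonneg_left ?_ p4
    rw [pow_zero, mul_one] at q0
    have q1 := mul_le_mul_of_nonneg_left q0 hw0.le
    have q2 : K₂ * (1 - h ^ 2) ≤ K * (1 - h ^ 2) :=
      mul_le_mul_of_nonneg_right (by linarith) hw0.le
    have q3 : K₄ * (1 - h ^ 2) ≤ K * (1 - h ^ 2) :=
      mul_le_mul_of_nonneg_right (by linarith) hw0.le
    linarith

theorem hasDerivAt_alphaFn (y : ℝ) : HasDerivAt alphaFn (1/3 * (Real.cosh y + 1)) y :=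
  ((Real.hasDerivAt_sinh y).add (hasDerivAt_id y)).const_mul _

theorem strictMono_alphaFn : StrictMono alphaFn := fun a b h => by
  have := Real.sinh_strictMono h
  simp only [alphaFn]; linarith

theorem continuous_alphaFn : Continuous alphaFn :=
  continuous_iff_continuousAt.2 fun y => (hasDerivAt_alphaFn y).continuousAt

theorem surjective_alphaFn : Function.Surjective alphaFn := by
  refine continuous_alphaFn.surjective ?_ ?_
  · refine tendsto_atTop_mono' _ ?_ (tendsto_id.const_mul_atTop (show (0:ℝ) < 1/3 by norm_num))
    filter_upwards [eventually_ge_atTop 0] with y hy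
    have := Real.sinh_nonneg_iff.2 hy
    simp only [alphaFn, id]; linarith
  · refine tendsto_atBot_mono' _ ?_ (tendsto_id.const_mul_atBot (show (0:ℝ) < 1/3 by norm_num))
    filter_upwards [eventually_le_atBot 0] with y hy
    have := Real.sinh_nonpos_iff.2 hy
    simp only [alphaFn, id]; linarith

theorem alphaFn_alphaInv (x : ℝ) : alphaFn (alphaInv x) = x :=
  Function.rightInverse_invFun surjective_alphaFn x

theorem alphaInv_alphaFn (y : ℝ) : alphaInv (alphaFn y) = y :=
  strictMono_alphaFn.injective (alphaFn_alphaInv _)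

theorem alphaInv_zero : alphaInv 0 = 0 := by
  simpa [alphaFn] using alphaInv_alphaFn 0

theorem strictMono_alphaInv : StrictMono alphaInv := fun a b h => by
  rw [← strictMono_alphaFn.lt_iff_lt, alphaFn_alphaInv, alphaFn_alphaInv]; exact h

theorem continuous_alphaInv : Continuous alphaInv :=
  strictMono_alphaInv.monotone.continuous_of_surjective
    fun y => ⟨alphaFn y, alphaInv_alphaFn y⟩

theorem hasDerivAt_alphaInv (x : ℝ) :
    HasDerivAt alphaInv (1/3 * (Real.cosh (alphaInv x) + 1))⁻¹ x :=
  HasDerivAt.of_local_left_inverse continuous_alphaInv.continuousAt (hasDerivAt_alphaFn _)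
    (by have := Real.cosh_pos (alphaInv x); positivity)
    (Eventually.of_forall alphaFn_alphaInv)

theorem Ht_zero : Ht 0 = 0 := by simp [Ht, Hs, alphaInv_zero]

theorem Ht_nonneg {x : ℝ} (hx : 0 ≤ x) : 0 ≤ Ht x := by
  have := strictMono_alphaInv.monotone hx
  rw [alphaInv_zero] at this
  rw [Ht, Hs, Real.tanh_eq_sinh_div_cosh]
  exact div_nonneg (Real.sinh_nonneg_iff.2 (by linarith)) (Real.cosh_pos _).le

theorem Ht_nonpos {x : ℝ} (hx : x ≤ 0) : Ht x ≤ 0 := by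
  have := strictMono_alphaInv.monotone hx
  rw [alphaInv_zero] at this
  rw [Ht, Hs, Real.tanh_eq_sinh_div_cosh]
  exact div_nonpos_of_nonpos_of_nonneg (Real.sinh_nonpos_iff.2 (by linarith)) (Real.cosh_pos _).le

theorem one_sub_tanh_sq (y : ℝ) : 1 - Real.tanh y ^ 2 = (1 / Real.cosh y) ^ 2 := by
  have := Real.cosh_sq y
  have h := (Real.cosh_pos y).ne'
  rw [Real.tanh_eq_sinh_div_cosh]
  field_simp
  linarith

theorem one_sub_Ht_sq (x : ℝ) : 1 - Ht x ^ 2 = (1 / Real.cosh (alphaInv x / 2)) ^ 2 :=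
  one_sub_tanh_sq _

theorem one_sub_Ht_sq_pos (x : ℝ) : 0 < 1 - Ht x ^ 2 := by
  rw [one_sub_Ht_sq]
  have := Real.cosh_pos (alphaInv x / 2)
  positivity

theorem abs_Ht_lt_one (x : ℝ) : |Ht x| < 1 := by
  rw [← sq_lt_one_iff_abs_lt_one]; linarith [one_sub_Ht_sq_pos x]

theorem Qt_eq (x : ℝ) : Qt x = 3/2 * (1 - Ht x ^ 2) := by
  rw [one_sub_Ht_sq]; rfl

theorem one_add_cosh (y : ℝ) : Real.cosh y + 1 = 2 * Real.cosh (y / 2) ^ 2 := by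
  have h1 := Real.cosh_two_mul (y / 2)
  have h2 := Real.cosh_sq (y / 2)
  rw [mul_div_cancel₀ y two_ne_zero] at h1
  linarith

theorem hasDerivAt_Ht (x : ℝ) : HasDerivAt Ht (3/4 * (1 - Ht x ^ 2) ^ 2) x := by
  have h1 : HasDerivAt Hs (1/2 * (1 / Real.cosh (alphaInv x / 2)) ^ 2) (alphaInv x) := by
    have hc := (Real.cosh_pos (alphaInv x / 2)).ne'
    have e : Hs = fun y => Real.sinh (y / 2) / Real.cosh (y / 2) := by
      funext y; rw [Hs, Real.tanh_eq_sinh_div_cosh]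
    rw [e]
    have hd : HasDerivAt (fun y : ℝ => y / 2) (1 / 2) (alphaInv x) :=
      (hasDerivAt_id _).div_const 2
    refine (hd.sinh.div hd.cosh hc).congr_deriv ?_
    have := Real.cosh_sq (alphaInv x / 2)
    field_simp
    linarith
  refine (h1.comp x (hasDerivAt_alphaInv x)).congr_deriv ?_
  rw [one_sub_Ht_sq, one_add_cosh]
  have hc := (Real.cosh_pos (alphaInv x / 2)).ne'
  field_simp
  norm_num

theorem continuous_Ht : Continuous Ht :=
  continuous_iff_continuousAt.2 fun x => (hasDerivAt_Ht x).continuousAt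

theorem deriv_Ht : deriv Ht = fun x => 3/4 * (1 - Ht x ^ 2) ^ 2 :=
  funext fun x => (hasDerivAt_Ht x).deriv

theorem hasDerivAt_eval_Ht (A : ℝ[X]) (x : ℝ) :
    HasDerivAt (fun x => A.eval (Ht x)) ((pD A).eval (Ht x)) x := by
  refine ((A.hasDerivAt (Ht x)).comp x (hasDerivAt_Ht x)).congr_deriv ?_
  simp [pD, eval_pW]; ring

theorem hasDerivAt_deriv_Ht (x : ℝ) :
    HasDerivAt (deriv Ht) (-(Qt x ^ 2 * (Ht x - Ht x ^ 3))) x := by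
  rw [deriv_Ht]
  refine (((((hasDerivAt_Ht x).pow 2).const_sub 1).pow 2).const_mul (3/4)).congr_deriv ?_
  rw [Qt_eq]; simp; ring

theorem abs_mul_one_sub_Ht_sq_le (x : ℝ) : |x| * (1 - Ht x ^ 2) ≤ 4/3 := by
  obtain ⟨y, rfl⟩ := surjective_alphaFn x
  have hc := Real.cosh_pos y
  have e : 1 - Ht (alphaFn y) ^ 2 = 2 / (Real.cosh y + 1) := by
    rw [one_sub_Ht_sq, alphaInv_alphaFn, one_add_cosh]
    have hc := (Real.cosh_pos (y / 2)).ne'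
    field_simp
  have h1 : |Real.sinh y| ≤ Real.cosh y := by
    refine abs_le_of_sq_le_sq ?_ hc.le
    linarith [Real.cosh_sq y]
  have h2 : |y| ≤ |Real.sinh y| := by
    rcases le_total 0 y with h | h
    · rw [abs_of_nonneg h, abs_of_nonneg (Real.sinh_nonneg_iff.2 h)]
      exact Real.self_le_sinh_iff.2 h
    · rw [abs_of_nonpos h, abs_of_nonpos (Real.sinh_nonpos_iff.2 h)]
      linarith [Real.sinh_le_self_iff.2 h]
  have h3 : |alphaFn y| ≤ 2/3 * (Real.cosh y + 1) := by
    rw [alphaFn, abs_mul, abs_of_nonneg (by norm_num : (0:ℝ) ≤ 1/3)]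
    linarith [abs_add_le (Real.sinh y) y]
  rw [e, mul_div_assoc', div_le_iff₀ (by linarith)]
  linarith

/-- `u` is, on `t > 0`, the perturbation of the kink by a classical solution whose energy norm
is at most `ε`. -/
structure IsPerturbation (ε : ℝ) (u ut ux utt utx uxx : ℝ → ℝ → ℝ) : Prop where
  u_t : ∀ t > 0, ∀ x, HasDerivAt (fun s => u s x) (ut t x) t
  u_x : ∀ t > 0, ∀ x, HasDerivAt (u t) (ux t x) x
  ut_t : ∀ t > 0, ∀ x, HasDerivAt (fun s => ut s x) (utt t x) t
  ut_x : ∀ t > 0, ∀ x, HasDerivAt (ut t) (utx t x) x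
  ux_t : ∀ t > 0, ∀ x, HasDerivAt (fun s => ux s x) (utx t x) t
  ux_x : ∀ t > 0, ∀ x, HasDerivAt (ux t) (uxx t x) x
  cont_u : ContinuousOn (fun p : ℝ × ℝ => u p.1 p.2) (Set.Ioi 0 ×ˢ Set.univ)
  cont_ut : ContinuousOn (fun p : ℝ × ℝ => ut p.1 p.2) (Set.Ioi 0 ×ˢ Set.univ)
  cont_ux : ContinuousOn (fun p : ℝ × ℝ => ux p.1 p.2) (Set.Ioi 0 ×ˢ Set.univ)
  cont_utt : ContinuousOn (fun p : ℝ × ℝ => utt p.1 p.2) (Set.Ioi 0 ×ˢ Set.univ)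
  cont_utx : ContinuousOn (fun p : ℝ × ℝ => utx p.1 p.2) (Set.Ioi 0 ×ˢ Set.univ)
  cont_uxx : ContinuousOn (fun p : ℝ × ℝ => uxx p.1 p.2) (Set.Ioi 0 ×ˢ Set.univ)
  eqn : ∀ t > 0, ∀ x, utt t x = uxx t x - Gu (Ht x) (u t x)
  integrable_ux : ∀ t > 0, Integrable fun x => ux t x ^ 2
  integrable_u : ∀ t > 0, Integrable fun x => Qt x ^ 2 * u t x ^ 2
  integrable_ut : ∀ t > 0, Integrable fun x => ut t x ^ 2
  integral_ux : ∀ t > 0, ∫ x, ux t x ^ 2 ≤ ε ^ 2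
  integral_u : ∀ t > 0, ∫ x, Qt x ^ 2 * u t x ^ 2 ≤ ε ^ 2
  integral_ut : ∀ t > 0, ∫ x, ut t x ^ 2 ≤ ε ^ 2

theorem hasDerivAt_fst {f : ℝ × ℝ → ℝ} {t x : ℝ} (hf : DifferentiableAt ℝ f (t, x)) :
    HasDerivAt (fun s => f (s, x)) (fderiv ℝ f (t, x) (1, 0)) t :=
  hf.hasFDerivAt.comp_hasDerivAt t ((hasDerivAt_id t).prodMk (hasDerivAt_const t x))

theorem hasDerivAt_snd {f : ℝ × ℝ → ℝ} {t x : ℝ} (hf : DifferentiableAt ℝ f (t, x)) :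
    HasDerivAt (fun y => f (t, y)) (fderiv ℝ f (t, x) (0, 1)) x :=
  hf.hasFDerivAt.comp_hasDerivAt x ((hasDerivAt_const x t).prodMk (hasDerivAt_id x))

theorem exists_isPerturbation {δ : ℝ} {φ : ℝ → ℝ → ℝ}
    (hφ : ContDiffOn ℝ 2 (fun p : ℝ × ℝ => φ p.1 p.2) (Set.Ici (0:ℝ) ×ˢ Set.univ))
    (heq : ∀ t ≥ (0:ℝ), ∀ x : ℝ,
        deriv (deriv (fun s => φ s x)) t - deriv (deriv (fun y => φ t y)) x
          - (Qt x)^2 * (φ t x - (φ t x)^3) = 0)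
    (hint : ∀ t ≥ (0:ℝ),
        Integrable (fun x => (deriv (fun y => φ t y) x - deriv Ht x)^2) ∧
        Integrable (fun x => (Qt x * (φ t x - Ht x))^2) ∧
        Integrable (fun x => (Qt x * (1 - (φ t x)^2))^2) ∧
        Integrable (fun x => (deriv (fun s => φ s x) t)^2))
    (hδ : ∀ t ≥ (0:ℝ),
        Real.sqrt ((∫ x, (deriv (fun y => φ t y) x - deriv Ht x)^2)
          + (∫ x, (Qt x)^2 * (φ t x - Ht x)^2)
          + (∫ x, (deriv (fun s => φ s x) t)^2)) < δ) :
    ∃ utt utx uxx : ℝ → ℝ → ℝ, IsPerturbation δ (fun t x => φ t x - Ht x)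
      (fun t x => deriv (fun s => φ s x) t) (fun t x => deriv (fun y => φ t y) x - deriv Ht x)
      utt utx uxx := by
  set f : ℝ × ℝ → ℝ := fun p => φ p.1 p.2 with hf
  set S : Set (ℝ × ℝ) := Set.Ioi 0 ×ˢ Set.univ with hS
  have hSo : IsOpen S := isOpen_Ioi.prod isOpen_univ
  have hfS : ContDiffOn ℝ 2 f S := hφ.mono (Set.prod_mono Set.Ioi_subset_Ici_self subset_rfl)
  have hf1 : ContDiffOn ℝ 1 (fderiv ℝ f) S := hfS.fderiv_of_isOpen hSo (by norm_num)
  have hfe (e : ℝ × ℝ) : ContDiffOn ℝ 1 (fun p => fderiv ℝ f p e) S :=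
    hf1.clm_apply contDiffOn_const
  have hfee (e e' : ℝ × ℝ) : ContinuousOn (fun p => fderiv ℝ (fun p => fderiv ℝ f p e) p e') S :=
    ((hfe e).continuousOn_fderiv_of_isOpen hSo le_rfl).clm_apply continuousOn_const
  have mem {t : ℝ} (ht : 0 < t) (x : ℝ) : (t, x) ∈ S := ⟨ht, trivial⟩
  have df {t : ℝ} (ht : 0 < t) (x : ℝ) : DifferentiableAt ℝ f (t, x) :=
    (hfS.contDiffAt (hSo.mem_nhds (mem ht x))).differentiableAt (by norm_num)
  have dfe (e : ℝ × ℝ) {t : ℝ} (ht : 0 < t) (x : ℝ) :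
      DifferentiableAt ℝ (fun p => fderiv ℝ f p e) (t, x) :=
    ((hfe e).contDiffAt (hSo.mem_nhds (mem ht x))).differentiableAt (by norm_num)
  have d_t {t : ℝ} (ht : 0 < t) (x : ℝ) : deriv (fun s => φ s x) t = fderiv ℝ f (t, x) (1, 0) :=
    (hasDerivAt_fst (df ht x)).deriv
  have d_x {t : ℝ} (ht : 0 < t) (x : ℝ) : deriv (fun y => φ t y) x = fderiv ℝ f (t, x) (0, 1) :=
    (hasDerivAt_snd (df ht x)).deriv
  have ev_t {t : ℝ} (ht : 0 < t) (x : ℝ) : (fun s => deriv (fun s => φ s x) s) =ᶠ[nhds t]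
      fun s => fderiv ℝ f (s, x) (1, 0) := by
    filter_upwards [lt_mem_nhds ht] with s hs using d_t hs x
  have ev_tx {t : ℝ} (ht : 0 < t) (x : ℝ) : (fun s => deriv (fun y => φ s y) x) =ᶠ[nhds t]
      fun s => fderiv ℝ f (s, x) (0, 1) := by
    filter_upwards [lt_mem_nhds ht] with s hs using d_x hs x
  have fun_x {t : ℝ} (ht : 0 < t) : (fun x => deriv (fun y => φ t y) x) =
      fun x => fderiv ℝ f (t, x) (0, 1) := funext fun x => d_x ht x
  have fun_t {t : ℝ} (ht : 0 < t) : (fun x => deriv (fun s => φ s x) t) =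
      fun x => fderiv ℝ f (t, x) (1, 0) := funext fun x => d_t ht x
  have symm {t : ℝ} (ht : 0 < t) (x : ℝ) :
      fderiv ℝ (fun p => fderiv ℝ f p (1, 0)) (t, x) (0, 1) =
      fderiv ℝ (fun p => fderiv ℝ f p (0, 1)) (t, x) (1, 0) := by
    have hs : IsSymmSndFDerivAt ℝ f (t, x) :=
      (hfS.contDiffAt (hSo.mem_nhds (mem ht x))).isSymmSndFDerivAt (by simp)
    have hd : DifferentiableAt ℝ (fderiv ℝ f) (t, x) :=
      (hf1.contDiffAt (hSo.mem_nhds (mem ht x))).differentiableAt (by norm_num)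
    have e (v w : ℝ × ℝ) : fderiv ℝ (fun p => fderiv ℝ f p v) (t, x) w =
        fderiv ℝ (fderiv ℝ f) (t, x) w v := by
      rw [fderiv_clm_apply hd (differentiableAt_const v)]; simp
    rw [e, e]; exact hs _ _
  have contHt : ContinuousOn (fun p : ℝ × ℝ => Ht p.2) S :=
    (continuous_Ht.comp continuous_snd).continuousOn
  have tt {t : ℝ} (ht : 0 < t) (x : ℝ) : HasDerivAt (fun s => deriv (fun s => φ s x) s)
      (fderiv ℝ (fun p => fderiv ℝ f p (1, 0)) (t, x) (1, 0)) t :=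
    (hasDerivAt_fst (dfe _ ht x)).congr_of_eventuallyEq (ev_t ht x)
  have xx {t : ℝ} (ht : 0 < t) (x : ℝ) : HasDerivAt (fun x => deriv (fun y => φ t y) x)
      (fderiv ℝ (fun p => fderiv ℝ f p (0, 1)) (t, x) (0, 1)) x := by
    rw [fun_x ht]; exact hasDerivAt_snd (dfe _ ht x)
  have en {t : ℝ} (ht : 0 < t) :
      (∫ x, (deriv (fun y => φ t y) x - deriv Ht x)^2) ≤ δ ^ 2 ∧
      (∫ x, (Qt x)^2 * (φ t x - Ht x)^2) ≤ δ ^ 2 ∧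
      (∫ x, (deriv (fun s => φ s x) t)^2) ≤ δ ^ 2 := by
    have h1 := hδ t ht.le
    have hδ0 : 0 < δ := (Real.sqrt_nonneg _).trans_lt h1
    rw [Real.sqrt_lt' hδ0] at h1
    have p1 : 0 ≤ ∫ x, (deriv (fun y => φ t y) x - deriv Ht x)^2 :=
      integral_nonneg fun x => sq_nonneg _
    have p2 : 0 ≤ ∫ x, (Qt x)^2 * (φ t x - Ht x)^2 :=
      integral_nonneg fun x => by positivity
    have p3 : 0 ≤ ∫ x, (deriv (fun s => φ s x) t)^2 := integral_nonneg fun x => sq_nonneg _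
    refine ⟨?_, ?_, ?_⟩ <;> linarith
  refine ⟨fun t x => fderiv ℝ (fun p => fderiv ℝ f p (1, 0)) (t, x) (1, 0),
    fun t x => fderiv ℝ (fun p => fderiv ℝ f p (1, 0)) (t, x) (0, 1),
    fun t x => fderiv ℝ (fun p => fderiv ℝ f p (0, 1)) (t, x) (0, 1)
      + Qt x ^ 2 * (Ht x - Ht x ^ 3), ?_⟩
  refine
    { u_t := fun t ht x => ?_
      u_x := fun t ht x => ?_
      ut_t := fun t ht x => tt ht x
      ut_x := fun t ht x => ?_
      ux_t := fun t ht x => ?_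
      ux_x := fun t ht x => ?_
      cont_u := hfS.continuousOn.sub contHt
      cont_ut := ((hfe (1, 0)).continuousOn).congr fun p hp => d_t hp.1 p.2
      cont_ux := ?_
      cont_utt := hfee _ _
      cont_utx := hfee _ _
      cont_uxx := ?_
      eqn := fun t ht x => ?_
      integrable_ux := fun t ht => (hint t ht.le).1
      integrable_u := fun t ht => ?_
      integrable_ut := fun t ht => (hint t ht.le).2.2.2
      integral_ux := fun t ht => (en ht).1
      integral_u := fun t ht => (en ht).2.1
      integral_ut := fun t ht => (en ht).2.2 }
  · simp only [d_t ht x]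
    exact (hasDerivAt_fst (df ht x)).sub_const _
  · simp only [d_x ht x]
    exact (hasDerivAt_snd (df ht x)).sub (hasDerivAt_Ht x).differentiableAt.hasDerivAt
  · rw [fun_t ht]
    exact hasDerivAt_snd (dfe _ ht x)
  · simp only [symm ht x]
    exact ((hasDerivAt_fst (dfe _ ht x)).congr_of_eventuallyEq (ev_tx ht x)).sub_const _
  · exact ((xx ht x).sub (hasDerivAt_deriv_Ht x)).congr_deriv (sub_neg_eq_add _ _)
  · refine ContinuousOn.sub (((hfe (0, 1)).continuousOn).congr fun p hp => d_x hp.1 p.2) ?_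
    rw [deriv_Ht]
    fun_prop
  · refine (hfee _ _).add ?_
    simp only [Qt_eq]
    fun_prop
  · have e1 : deriv (deriv fun s => φ s x) t = _ := (tt ht x).deriv
    have e2 : deriv (deriv fun y => φ t y) x = _ := (xx ht x).deriv
    have := heq t ht.le x
    rw [e1, e2] at this
    simp only [Gu]
    rw [Qt_eq] at *
    linear_combination this
  · simpa only [mul_pow] using (hint t ht.le).2.1

theorem abs_intervalIntegral_le_integral {G : ℝ → ℝ} (hG : Integrable G) (h0 : ∀ x, 0 ≤ G x)
    (a b : ℝ) : |∫ x in a..b, G x| ≤ ∫ x, G x := by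
  rw [intervalIntegral.abs_intervalIntegral_eq, abs_of_nonneg (integral_nonneg h0)]
  exact setIntegral_le_integral hG (Eventually.of_forall h0)

theorem exists_weighted_sup_bound : ∃ C > 0, ∀ (f f' : ℝ → ℝ) (ε : ℝ),
    (∀ x, HasDerivAt f (f' x) x) → Continuous f' →
    Integrable (fun x => f' x ^ 2) → Integrable (fun x => Qt x ^ 2 * f x ^ 2) →
    ∫ x, f' x ^ 2 ≤ ε ^ 2 → ∫ x, Qt x ^ 2 * f x ^ 2 ≤ ε ^ 2 →
    ∀ x, (1 - Ht x ^ 2) * f x ^ 2 ≤ (C * ε) ^ 2 := by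
  have hw : Continuous fun x => 1 - Ht x ^ 2 := by have := continuous_Ht; fun_prop
  obtain ⟨x₀, -, hx₀⟩ := isCompact_Icc.exists_isMinOn (Set.nonempty_Icc.2 zero_le_one)
    (hw.continuousOn (s := Set.Icc 0 1))
  obtain ⟨m, hm⟩ : ∃ m, m = 1 - Ht x₀ ^ 2 := ⟨_, rfl⟩
  have hm0 : 0 < m := hm ▸ one_sub_Ht_sq_pos x₀
  refine ⟨3 + 1 / m, by positivity, fun f f' ε hf hf' i1 i2 b1 b2 x => ?_⟩
  have hfc : Continuous f := continuous_iff_continuousAt.2 fun x => (hf x).continuousAt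
  have hH := continuous_Ht
  have hQ : Continuous Qt := by
    rw [show Qt = _ from funext Qt_eq]; fun_prop
  obtain ⟨G, hG⟩ : ∃ G : ℝ → ℝ, G = fun x => 10/9 * (Qt x ^ 2 * f x ^ 2) + f' x ^ 2 := ⟨_, rfl⟩
  have hGi : Integrable G := hG ▸ (i2.const_mul _).add i1
  have hG0 (x) : 0 ≤ G x := by rw [hG]; positivity
  have hGb : ∫ x, G x ≤ 19/9 * ε ^ 2 := by
    rw [hG, integral_add (i2.const_mul _) i1, integral_const_mul]
    linarith
  obtain ⟨g, hg⟩ : ∃ g : ℝ → ℝ, g = fun x => (1 - Ht x ^ 2) * f x ^ 2 := ⟨_, rfl⟩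
  obtain ⟨g', hg'⟩ : ∃ g' : ℝ → ℝ, g' = fun x =>
    -(3/2 * Ht x * (1 - Ht x ^ 2) ^ 2) * f x ^ 2 + (1 - Ht x ^ 2) * (2 * f x * f' x) := ⟨_, rfl⟩
  have hgd (x) : HasDerivAt g (g' x) x := by
    rw [hg, hg']
    refine ((((hasDerivAt_Ht x).pow 2).const_sub 1).mul ((hf x).pow 2)).congr_deriv ?_
    simp only [Nat.cast_ofNat, Nat.add_one_sub_one, pow_one, Pi.pow_apply]; ring
  have hg'c : Continuous g' := by rw [hg']; fun_prop
  have hg'b (x) : ‖g' x‖ ≤ G x := by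
    have hx := abs_lt.1 (abs_Ht_lt_one x)
    have p := sq_nonneg ((1 - Ht x ^ 2) * f x)
    simp only [Real.norm_eq_abs, hg', hG, Qt_eq, abs_le]
    have s1 := sq_nonneg ((1 - Ht x ^ 2) * f x + f' x)
    have s2 := sq_nonneg ((1 - Ht x ^ 2) * f x - f' x)
    have s3 := mul_nonneg (by linarith : 0 ≤ 1 + Ht x) p
    have s4 := mul_nonneg (by linarith : 0 ≤ 1 - Ht x) p
    constructor <;> linarith
  have hxy (y : ℝ) : g x ≤ g y + 19/9 * ε ^ 2 := by
    have e : ∫ z in y..x, g' z = g x - g y :=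
      intervalIntegral.integral_eq_sub_of_hasDerivAt (fun z _ => hgd z)
        (hg'c.intervalIntegrable _ _)
    have h1 : ‖∫ z in y..x, g' z‖ ≤ |∫ z in y..x, G z| :=
      intervalIntegral.norm_integral_le_abs_of_norm_le (Eventually.of_forall fun z => hg'b z)
        (hGi.intervalIntegrable)
    have h2 := abs_intervalIntegral_le_integral hGi hG0 y x
    rw [e] at h1
    linarith [le_of_abs_le h1]
  have hgy : ∀ y ∈ Set.Icc (0:ℝ) 1, g y ≤ 1 / m * (Qt y ^ 2 * f y ^ 2) := by
    intro y hy
    have hwy : m ≤ 1 - Ht y ^ 2 := hm ▸ hx₀ hy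
    have hp : 0 ≤ (1 - Ht y ^ 2) * f y ^ 2 := by
      have := one_sub_Ht_sq_pos y; positivity
    simp only [hg, Qt_eq]
    rw [one_div, ← div_eq_inv_mul, le_div_iff₀ hm0]
    have h1 := mul_le_mul_of_nonneg_left hwy hp
    have h2 := mul_nonneg (one_sub_Ht_sq_pos y).le hp
    linarith
  have hgc : Continuous g := by rw [hg]; fun_prop
  have avg : g x ≤ 1 / m * ε ^ 2 + 19/9 * ε ^ 2 := by
    have h1 : ∫ _ in (0:ℝ)..1, g x ≤ ∫ y in (0:ℝ)..1, (1 / m * (Qt y ^ 2 * f y ^ 2)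
        + 19/9 * ε ^ 2) := by
      refine intervalIntegral.integral_mono_on zero_le_one (by simp)
        (Continuous.intervalIntegrable (by fun_prop) _ _) fun y hy => ?_
      linarith [hxy y, hgy y hy]
    rw [intervalIntegral.integral_add (Continuous.intervalIntegrable (by fun_prop) _ _)
      (by simp), intervalIntegral.integral_const_mul] at h1
    have h2 := (le_abs_self _).trans (abs_intervalIntegral_le_integral i2
      (fun x => by positivity) 0 1)
    have h3 : 1 / m * ∫ y in (0:ℝ)..1, Qt y ^ 2 * f y ^ 2 ≤ 1 / m * ε ^ 2 :=
      mul_le_mul_of_nonneg_left (h2.trans b2) (by positivity)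
    simp only [intervalIntegral.integral_const, sub_zero, one_smul] at h1
    linarith
  have hM : 1 / m * ε ^ 2 + 19/9 * ε ^ 2 ≤ ((3 + 1 / m) * ε) ^ 2 := by
    have h0 : 0 ≤ 1 / m := by positivity
    have h1 : 1 / m + 19/9 ≤ (3 + 1 / m) ^ 2 := by linarith [sq_nonneg (1 / m)]
    rw [mul_pow, ← add_mul]
    exact mul_le_mul_of_nonneg_right h1 (sq_nonneg ε)
  rw [hg] at avg
  exact avg.trans hM

theorem hasDerivAt_integral_of_continuousOn {F F' : ℝ → ℝ → ℝ}
    (hd : ∀ t > 0, ∀ x, HasDerivAt (fun s => F s x) (F' t x) t)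
    (hF : ContinuousOn (fun p : ℝ × ℝ => F p.1 p.2) (Set.Ioi 0 ×ˢ Set.univ))
    (hF' : ContinuousOn (fun p : ℝ × ℝ => F' p.1 p.2) (Set.Ioi 0 ×ˢ Set.univ))
    (a b : ℝ) {t : ℝ} (ht : 0 < t) :
    HasDerivAt (fun t => ∫ x in a..b, F t x) (∫ x in a..b, F' t x) t := by
  have slice {G : ℝ → ℝ → ℝ}
      (hG : ContinuousOn (fun p : ℝ × ℝ => G p.1 p.2) (Set.Ioi 0 ×ˢ Set.univ)) {s : ℝ}
      (hs : 0 < s) : Continuous (G s) := by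
    rw [← continuousOn_univ]
    exact hG.comp (f := fun x => (s, x)) (by fun_prop) fun x _ => ⟨hs, trivial⟩
  have hsub : Set.Icc (t / 2) (2 * t) ×ˢ Set.uIcc a b ⊆ Set.Ioi 0 ×ˢ Set.univ :=
    Set.prod_mono (fun s hs => lt_of_lt_of_le (by positivity) hs.1) (Set.subset_univ _)
  obtain ⟨C, hC⟩ := (isCompact_Icc.prod isCompact_uIcc).exists_bound_of_continuousOn
    (hF'.mono hsub)
  refine (intervalIntegral.hasDerivAt_integral_of_dominated_loc_of_deriv_le (bound := fun _ => C)
    (Ioo_mem_nhds (by linarith : t / 2 < t) (by linarith : t < 2 * t)) ?_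
    ((slice hF ht).intervalIntegrable _ _) (slice hF' ht).aestronglyMeasurable ?_ (by simp)
    ?_).2
  · filter_upwards [lt_mem_nhds ht] with s hs using (slice hF hs).aestronglyMeasurable
  · refine Eventually.of_forall fun x hx s hs => hC (s, x) ⟨Set.Ioo_subset_Icc_self hs, ?_⟩
    exact Set.uIoc_subset_uIcc hx
  · exact Eventually.of_forall fun x _ s hs => hd s (lt_trans (by positivity) hs.1) x

/-- Spatial cutoff. -/
noncomputable def cutoff (R x : ℝ) : ℝ := (1 - x ^ 2 / R ^ 2) ^ 2

noncomputable def cutoff' (R x : ℝ) : ℝ := -(4 * x / R ^ 2) * (1 - x ^ 2 / R ^ 2)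

noncomputable def cutoff'' (R x : ℝ) : ℝ := -(4 / R ^ 2) + 12 * x ^ 2 / R ^ 4

theorem hasDerivAt_cutoff (R x : ℝ) : HasDerivAt (cutoff R) (cutoff' R x) x := by
  refine (((((hasDerivAt_id x).pow 2).div_const (R ^ 2)).const_sub 1).pow 2).congr_deriv ?_
  simp [cutoff']; ring

theorem hasDerivAt_cutoff' (R x : ℝ) : HasDerivAt (cutoff' R) (cutoff'' R x) x := by
  have h1 : HasDerivAt (fun x : ℝ => -(4 * x / R ^ 2)) (-(4 * 1 / R ^ 2)) x :=
    (((hasDerivAt_id x).const_mul 4).div_const _).neg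
  have h2 : HasDerivAt (fun x : ℝ => 1 - x ^ 2 / R ^ 2) (-(2 * x / R ^ 2)) x := by
    simpa using (((hasDerivAt_id x).pow 2).div_const (R ^ 2)).const_sub 1
  refine (h1.mul h2).congr_deriv ?_
  simp only [cutoff'']; ring

theorem continuous_cutoff (R : ℝ) : Continuous (cutoff R) := by unfold cutoff; fun_prop
theorem continuous_cutoff' (R : ℝ) : Continuous (cutoff' R) := by unfold cutoff'; fun_prop
theorem continuous_cutoff'' (R : ℝ) : Continuous (cutoff'' R) := by unfold cutoff''; fun_prop

theorem cutoff_self {R : ℝ} (hR : 0 < R) : cutoff R R = 0 := by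
  simp [cutoff, div_self (pow_ne_zero 2 hR.ne')]
theorem cutoff_neg_self {R : ℝ} (hR : 0 < R) : cutoff R (-R) = 0 := by
  simp [cutoff, div_self (pow_ne_zero 2 hR.ne')]
theorem cutoff'_self {R : ℝ} (hR : 0 < R) : cutoff' R R = 0 := by
  simp [cutoff', div_self (pow_ne_zero 2 hR.ne')]
theorem cutoff'_neg_self {R : ℝ} (hR : 0 < R) : cutoff' R (-R) = 0 := by
  simp [cutoff', div_self (pow_ne_zero 2 hR.ne')]

theorem sq_div_sq_le_one {R x : ℝ} (hR : 0 < R) (hx : |x| ≤ R) : x ^ 2 / R ^ 2 ≤ 1 := by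
  rw [div_le_one (by positivity)]
  exact sq_le_sq' (abs_le.1 hx).1 (abs_le.1 hx).2

theorem cutoff_nonneg (R x : ℝ) : 0 ≤ cutoff R x := sq_nonneg _

theorem cutoff_le_one {R x : ℝ} (hR : 0 < R) (hx : |x| ≤ R) : cutoff R x ≤ 1 := by
  have h1 := sq_div_sq_le_one hR hx
  have h2 : 0 ≤ x ^ 2 / R ^ 2 := by positivity
  exact pow_le_one₀ (by linarith) (by linarith)

theorem abs_cutoff'_le {R x : ℝ} (hR : 0 < R) (hx : |x| ≤ R) : |cutoff' R x| ≤ 4 / R := by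
  have h1 := sq_div_sq_le_one hR hx
  have h2 : 0 ≤ x ^ 2 / R ^ 2 := by positivity
  rw [cutoff', abs_mul, abs_neg, abs_div, abs_mul, abs_of_nonneg (by positivity : 0 ≤ R ^ 2),
    abs_of_nonneg (by norm_num : (0:ℝ) ≤ 4), abs_of_nonneg (by linarith : 0 ≤ 1 - x ^ 2 / R ^ 2)]
  calc _ ≤ 4 * R / R ^ 2 * 1 := by gcongr; linarith
    _ = 4 / R := by field_simp

theorem abs_cutoff''_le {R x : ℝ} (hR : 1 ≤ R) (hx : |x| ≤ R) : |cutoff'' R x| ≤ 8 / R := by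
  have hR0 : 0 < R := by linarith
  have h1 := sq_div_sq_le_one hR0 hx
  have h2 : 0 ≤ x ^ 2 / R ^ 2 := by positivity
  have e : cutoff'' R x = (1 / R ^ 2) * (-4 + 12 * (x ^ 2 / R ^ 2)) := by
    rw [cutoff'']; field_simp
  have h3 : |-4 + 12 * (x ^ 2 / R ^ 2)| ≤ 8 := by rw [abs_le]; constructor <;> linarith
  rw [e, abs_mul, abs_of_nonneg (by positivity : 0 ≤ 1 / R ^ 2)]
  calc _ ≤ 1 / R ^ 1 * 8 := by
        gcongr
        · norm_num
    _ = 8 / R := by ring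

theorem mul_cutoff'_nonpos {R x y : ℝ} (hR : 0 < R) (hx : |x| ≤ R) (hy : 0 ≤ x * y) :
    y * cutoff' R x ≤ 0 := by
  have h1 := sq_div_sq_le_one hR hx
  have : 0 ≤ 4 * (x * y) / R ^ 2 * (1 - x ^ 2 / R ^ 2) :=
    mul_nonneg (by positivity) (by linarith)
  rw [cutoff']
  linear_combination this

theorem one_sub_cutoff_mul_le {R x : ℝ} (hR : 0 < R) (hx : |x| ≤ R) :
    (1 - cutoff R x) * (1 - Ht x ^ 2) ≤ 8/3 / R := by
  have h2 : 0 ≤ x ^ 2 / R ^ 2 := by positivity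
  have h3 : x ^ 2 / R ^ 2 ≤ |x| / R := by
    rw [← sq_abs, ← div_pow]
    exact pow_le_of_le_one (by positivity) ((div_le_one hR).2 hx) (by norm_num)
  have h4 : 1 - cutoff R x ≤ 2 * (|x| / R) := by
    rw [cutoff]; linarith [sq_nonneg (x ^ 2 / R ^ 2)]
  calc _ ≤ 2 * (|x| / R) * (1 - Ht x ^ 2) :=
        mul_le_mul_of_nonneg_right h4 (one_sub_Ht_sq_pos x).le
    _ = 2 * (|x| * (1 - Ht x ^ 2)) / R := by ring
    _ ≤ _ := by gcongr; linarith [abs_mul_one_sub_Ht_sq_le x]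

theorem integral_eval_pD (A : ℝ[X]) (a b : ℝ) :
    ∫ x in a..b, (pD A).eval (Ht x) = A.eval (Ht b) - A.eval (Ht a) :=
  intervalIntegral.integral_eq_sub_of_hasDerivAt (fun x _ => hasDerivAt_eval_Ht A x)
    (((pD A).continuous.comp continuous_Ht).intervalIntegrable _ _)

theorem integral_weight_le (a b : ℝ) : ∫ x in a..b, (1 - Ht x ^ 2) ^ 2 ≤ 8/3 := by
  have h := integral_eval_pD (C (4/3) * X) a b
  have ha := abs_lt.1 (abs_Ht_lt_one a)
  have hb := abs_lt.1 (abs_Ht_lt_one b)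
  have e : ∀ x, (pD (C (4/3) * X)).eval x = (1 - x ^ 2) ^ 2 := fun x => by
    simp [pD, eval_pW]; ring
  simp only [e, eval_mul, eval_C, eval_X] at h
  linarith

theorem eval_pN_nonneg {h : ℝ} (hh : |h| < 1) : 0 ≤ pN.eval h := by
  have h1 := (sq_lt_one_iff_abs_lt_one h).2 hh
  obtain ⟨w, hw⟩ : ∃ w, w = 1 - h ^ 2 := ⟨_, rfl⟩
  have hw0 : 0 ≤ w := by linarith
  have hw1 : w ≤ 1 := by nlinarith
  have e : pN.eval h = w * (9/4 - 27/2 * w + 123/4 * w ^ 2 - 123/4 * w ^ 3 + 12 * w ^ 4) := by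
    have : h ^ 2 = 1 - w := by linarith
    simp only [pN, pT, eval_add, eval_sub, eval_mul, eval_pow, eval_C, eval_X, eval_pW,
      eval_ofNat, this]
    ring
  rw [e]
  refine mul_nonneg hw0 ?_
  nlinarith [sq_nonneg (w - 41/100), sq_nonneg (w ^ 2 - 41/32 * w + 2/5)]

theorem eval_pD_pPsi_lower (h : ℝ) : 3/4 * (1 - h ^ 2) ^ 2 ≤ (pD pPsi).eval h := by
  have : (pD pPsi).eval h = 3/4 * (1 - h ^ 2) ^ 2
      + 3/4 * (1 - h ^ 2) ^ 2 * (3 * h ^ 2 + 20 * h ^ 4) := by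
    simp [pD, pPsi, pW, derivative_pow]; ring
  rw [this]
  have : 0 ≤ 3/4 * (1 - h ^ 2) ^ 2 * (3 * h ^ 2 + 20 * h ^ 4) := by positivity
  linarith

theorem eval_pA (h : ℝ) : pA.eval h = 189/200 * (pD pPsi).eval h := by simp [pA]

theorem eval_pA_nonneg (h : ℝ) : 0 ≤ pA.eval h := by
  rw [eval_pA]
  have := eval_pD_pPsi_lower h
  have : 0 ≤ 3/4 * (1 - h ^ 2) ^ 2 := by positivity
  linarith

theorem continuousAt_sq_div {f g : ℝ → ℝ} {f' g' : ℝ} (hf : HasDerivAt f f' 0)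
    (hg : HasDerivAt g g' 0) (hf0 : f 0 = 0) (hg0 : g 0 = 0) (hg' : g' ≠ 0) :
    ContinuousAt (fun x => f x ^ 2 / g x) 0 := by
  have e : (fun x => f x ^ 2 / g x) = fun x => x * dslope f 0 x ^ 2 / dslope g 0 x := by
    funext x
    have h1 := sub_smul_dslope f 0 x
    have h2 := sub_smul_dslope g 0 x
    rw [hf0, sub_zero, sub_zero, smul_eq_mul] at h1
    rw [hg0, sub_zero, sub_zero, smul_eq_mul] at h2
    rw [← h1, ← h2]
    rcases eq_or_ne x 0 with rfl | hx
    · simp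
    · rw [mul_pow, sq x, mul_assoc, mul_div_mul_left _ _ hx]
  rw [e]
  have c1 := continuousAt_dslope_same.2 hf.differentiableAt
  have c2 := continuousAt_dslope_same.2 hg.differentiableAt
  refine (continuousAt_id.mul (c1.pow 2)).div c2 ?_
  rwa [dslope_same, hg.deriv]

noncomputable def virialDensity (R κ : ℝ) (u r : ℝ → ℝ) (x : ℝ) : ℝ :=
  cutoff R x * (pA.eval (Ht x) * r x ^ 2 - κ ^ 2 * (pA * pD pF ^ 2).eval (Ht x)
    + pE.eval (Ht x) * (u x - κ * pF.eval (Ht x)) ^ 2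
    + 2 * κ * (pD (pA * pD pF)).eval (Ht x) * (u x - κ * pF.eval (Ht x)))
  + 2 * κ * cutoff' R x * (pA * pD pF).eval (Ht x) * (u x - κ * pF.eval (Ht x))

theorem virial_algebra {h h' AN DAN N E a v v' ζ ζ' κ F r af Daf : ℝ} (hh : h ≠ 0) (ha : 0 ≤ a)
    (hζ : 0 ≤ ζ) (hE : h ^ 2 * E = h * DAN - AN * h' + a * N ^ 2) (hAN : AN = a * N) (hN : 0 ≤ N)
    (hζ' : h * ζ' ≤ 0) (hr : v' = r - κ * F) (haf : af = a * F) :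
    (ζ' * AN + ζ * DAN) * (v ^ 2 / h) + ζ * AN * ((2 * v * v' * h - v ^ 2 * h') / h ^ 2)
      + (2 * κ * (ζ' * af + ζ * Daf) * v + 2 * κ * (ζ * af) * v') ≤
    ζ * (a * r ^ 2 - κ ^ 2 * (a * F ^ 2) + E * v ^ 2 + 2 * κ * Daf * v) + 2 * κ * ζ' * af * v := by
  have hE' : E = (h * DAN - AN * h' + a * N ^ 2) / h ^ 2 := by
    field_simp; linarith
  have h1 : 0 ≤ ζ * (a * (v' - N * (v / h)) ^ 2) := by positivity
  have h2 : 0 ≤ -(h * ζ') * (AN * (v / h) ^ 2) :=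
    mul_nonneg (by linarith) (mul_nonneg (hAN ▸ mul_nonneg ha hN) (sq_nonneg _))
  rw [← sub_nonneg]
  refine (add_nonneg h1 h2).trans_eq ?_
  have hr' : r = v' + κ * F := by linarith
  rw [hE', hr', haf, hAN]
  field_simp
  ring

theorem integral_virialDensity_nonneg {R κ : ℝ} (hR : 0 < R) {u r : ℝ → ℝ}
    (hu : ∀ x, HasDerivAt u (r x) x) (hr : Continuous r) (hκ : u 0 = κ * pF.eval 0) :
    0 ≤ ∫ x in (-R)..R, virialDensity R κ u r x := by
  have hH := continuous_Ht
  have huc : Continuous u := continuous_iff_continuousAt.2 fun x => (hu x).continuousAt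
  have hev (A : ℝ[X]) : Continuous fun x => A.eval (Ht x) := A.continuous.comp hH
  have hζ := continuous_cutoff R
  have hζ' := continuous_cutoff' R
  have hφ : Continuous (virialDensity R κ u r) := by
    have := hev pA; have := hev (pA * pD pF ^ 2); have := hev pE; have := hev pF
    have := hev (pD (pA * pD pF)); have := hev (pA * pD pF)
    unfold virialDensity
    fun_prop
  obtain ⟨v, hv⟩ : ∃ v : ℝ → ℝ, v = fun x => u x - κ * pF.eval (Ht x) := ⟨_, rfl⟩
  have hvd (x) : HasDerivAt v (r x - κ * (pD pF).eval (Ht x)) x := by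
    rw [hv]; exact (hu x).sub ((hasDerivAt_eval_Ht pF x).const_mul κ)
  have hv0 : v 0 = 0 := by simp only [hv, Ht_zero, hκ, sub_self]
  have hvc : Continuous v := continuous_iff_continuousAt.2 fun x => (hvd x).continuousAt
  obtain ⟨Φ, hΦ⟩ : ∃ Φ : ℝ → ℝ, Φ = fun x =>
    (cutoff R x * (pA * pN).eval (Ht x)) * (v x ^ 2 / Ht x)
      + 2 * κ * (cutoff R x * (pA * pD pF).eval (Ht x)) * v x := ⟨_, rfl⟩
  have hHne {x : ℝ} (hx : x ≠ 0) : Ht x ≠ 0 := by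
    intro h
    have hm : StrictMono Ht := strictMono_of_deriv_pos fun x => by
      rw [deriv_Ht]; have := one_sub_Ht_sq_pos x; positivity
    exact hx (hm.injective (h.trans Ht_zero.symm))
  have hΦc : Continuous Φ := by
    have hq : Continuous fun x => v x ^ 2 / Ht x := by
      refine continuous_iff_continuousAt.2 fun x => ?_
      rcases eq_or_ne x 0 with rfl | hx
      · exact continuousAt_sq_div (hvd 0) (hasDerivAt_Ht 0) hv0 Ht_zero (by simp [Ht_zero])
      · exact (hvc.continuousAt.pow 2).div hH.continuousAt (hHne hx)
    have := hev (pA * pN); have := hev (pA * pD pF)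
    rw [hΦ]
    fun_prop
  have hΦd {x : ℝ} (hx : x ≠ 0) : HasDerivAt Φ
      ((cutoff' R x * (pA * pN).eval (Ht x) + cutoff R x * (pD (pA * pN)).eval (Ht x))
          * (v x ^ 2 / Ht x)
        + cutoff R x * (pA * pN).eval (Ht x) * ((2 * v x * (r x - κ * (pD pF).eval (Ht x)) * Ht x
          - v x ^ 2 * (3/4 * (1 - Ht x ^ 2) ^ 2)) / Ht x ^ 2)
        + (2 * κ * (cutoff' R x * (pA * pD pF).eval (Ht x)
            + cutoff R x * (pD (pA * pD pF)).eval (Ht x)) * v x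
          + 2 * κ * (cutoff R x * (pA * pD pF).eval (Ht x))
            * (r x - κ * (pD pF).eval (Ht x)))) x := by
    have d1 := ((hvd x).pow 2).div (hasDerivAt_Ht x) (hHne hx)
    have d2 := (hasDerivAt_cutoff R x).mul (hasDerivAt_eval_Ht (pA * pN) x)
    have d3 := ((hasDerivAt_cutoff R x).mul (hasDerivAt_eval_Ht (pA * pD pF) x)).const_mul (2 * κ)
    rw [hΦ]
    refine ((d2.mul d1).add (d3.mul (hvd x))).congr_deriv ?_
    simp only [Nat.cast_ofNat, Nat.add_one_sub_one, pow_one, Pi.pow_apply, Pi.mul_apply,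
      Pi.div_apply]
  have hle {x : ℝ} (hx : x ≠ 0) (hxR : |x| ≤ R) :
      ((cutoff' R x * (pA * pN).eval (Ht x) + cutoff R x * (pD (pA * pN)).eval (Ht x))
          * (v x ^ 2 / Ht x)
        + cutoff R x * (pA * pN).eval (Ht x) * ((2 * v x * (r x - κ * (pD pF).eval (Ht x)) * Ht x
          - v x ^ 2 * (3/4 * (1 - Ht x ^ 2) ^ 2)) / Ht x ^ 2)
        + (2 * κ * (cutoff' R x * (pA * pD pF).eval (Ht x)
            + cutoff R x * (pD (pA * pD pF)).eval (Ht x)) * v x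
          + 2 * κ * (cutoff R x * (pA * pD pF).eval (Ht x))
            * (r x - κ * (pD pF).eval (Ht x)))) ≤ virialDensity R κ u r x := by
    have hxH : 0 ≤ x * Ht x := by
      rcases le_total 0 x with h | h
      · exact mul_nonneg h (Ht_nonneg h)
      · exact mul_nonneg_of_nonpos_of_nonpos h (Ht_nonpos h)
    have hE := X_sq_mul_pE (Ht x)
    simp only [eval_mul (p := pA), eval_pow] at hE
    have := virial_algebra (F := (pD pF).eval (Ht x)) (r := r x) (κ := κ) (v := v x)
      (Daf := (pD (pA * pD pF)).eval (Ht x)) (hHne hx) (eval_pA_nonneg (Ht x))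
      (cutoff_nonneg R x) hE rfl (eval_pN_nonneg (abs_Ht_lt_one x))
      (mul_cutoff'_nonpos hR hxR hxH) rfl rfl
    simp only [virialDensity, eval_mul (p := pA), eval_pow]
    simpa only [hv] using this
  have h1 := intervalIntegral.sub_le_integral_of_hasDeriv_right_of_le
    (by linarith : -R ≤ 0) hΦc.continuousOn
    (fun x hx => (hΦd hx.2.ne).hasDerivWithinAt) hφ.continuousOn.integrableOn_Icc
    (fun x hx => hle hx.2.ne (abs_le.2 ⟨hx.1.le, hx.2.le.trans hR.le⟩))
  have h2 := intervalIntegral.sub_le_integral_of_hasDeriv_right_of_le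
    hR.le hΦc.continuousOn
    (fun x hx => (hΦd hx.1.ne').hasDerivWithinAt) hφ.continuousOn.integrableOn_Icc
    (fun x hx => hle hx.1.ne' (abs_le.2 ⟨(by linarith [hx.1]), hx.2.le⟩))
  have e1 : Φ (-R) = 0 := by simp [hΦ, cutoff_neg_self hR]
  have e2 : Φ R = 0 := by simp [hΦ, cutoff_self hR]
  rw [← intervalIntegral.integral_add_adjacent_intervals (hφ.intervalIntegrable (-R) 0)
    (hφ.intervalIntegrable 0 R)]
  linarith

/-- The nonlinear potential with `∂_u Gpot = Gu`. -/
noncomputable def Gpot (h u : ℝ) : ℝ :=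
  9/16 * (1 - h ^ 2) ^ 2 * u ^ 2 * ((2 * h + u) ^ 2 - 2 * (1 - h ^ 2))

/-- Time derivative of the localized momentum density. -/
noncomputable def momentumRate (R : ℝ) (u r p r' p' : ℝ → ℝ) (x : ℝ) : ℝ :=
  -(pPsi.eval (Ht x) * cutoff R x * p' x + 1/2 * pG.eval (Ht x) * cutoff R x * p x) * p x
  - (pPsi.eval (Ht x) * cutoff R x * r x + 1/2 * pG.eval (Ht x) * cutoff R x * u x)
    * (r' x - Gu (Ht x) (u x))

noncomputable def momentumFlux (R : ℝ) (u r p : ℝ → ℝ) (x : ℝ) : ℝ :=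
  -1/2 * pPsi.eval (Ht x) * cutoff R x * (p x ^ 2 + r x ^ 2)
  + pPsi.eval (Ht x) * cutoff R x * Gpot (Ht x) (u x)
  - 1/2 * pG.eval (Ht x) * cutoff R x * u x * r x
  + 1/4 * (pD pG).eval (Ht x) * cutoff R x * u x ^ 2

noncomputable def momentumSource (R : ℝ) (u r p : ℝ → ℝ) (x : ℝ) : ℝ :=
  cutoff R x * (1/2 * ((pD pPsi).eval (Ht x) - pG.eval (Ht x)) * p x ^ 2
    + 1/2 * ((pD pPsi).eval (Ht x) + pG.eval (Ht x)) * r x ^ 2 + Fc (Ht x) (u x) * u x ^ 2)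
  + cutoff' R x * (1/2 * pPsi.eval (Ht x) * (p x ^ 2 + r x ^ 2)
    - pPsi.eval (Ht x) * Gpot (Ht x) (u x) + 1/2 * pG.eval (Ht x) * u x * r x
    - 1/4 * (pD pG).eval (Ht x) * u x ^ 2)

theorem hasDerivAt_Gpot {u r : ℝ → ℝ} {x : ℝ} (hu : HasDerivAt u (r x) x) :
    HasDerivAt (fun x => Gpot (Ht x) (u x))
      (Gu (Ht x) (u x) * r x + 3/4 * (1 - Ht x ^ 2) ^ 2
        * (-(9/4) * Ht x * (1 - Ht x ^ 2) * u x ^ 2 * ((2 * Ht x + u x) ^ 2 - 2 * (1 - Ht x ^ 2))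
          + 9/16 * (1 - Ht x ^ 2) ^ 2 * u x ^ 2 * (12 * Ht x + 4 * u x))) x := by
  have hH := hasDerivAt_Ht x
  have hw := (hH.pow 2).const_sub 1
  unfold Gpot
  refine ((((hw.pow 2).const_mul (9/16)).mul (hu.pow 2)).mul
    ((((hH.const_mul 2).add hu).pow 2).sub (hw.const_mul 2))).congr_deriv ?_
  simp only [Nat.cast_ofNat, Nat.add_one_sub_one, pow_one, Pi.pow_apply, Pi.mul_apply,
    Pi.add_apply, Pi.sub_apply, Gu]
  ring

theorem hasDerivAt_momentumFlux {R : ℝ} {u r p r' p' : ℝ → ℝ} {x : ℝ}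
    (hu : HasDerivAt u (r x) x) (hr : HasDerivAt r (r' x) x) (hp : HasDerivAt p (p' x) x) :
    HasDerivAt (momentumFlux R u r p)
      (momentumRate R u r p r' p' x - momentumSource R u r p x) x := by
  have hζ := hasDerivAt_cutoff R x
  have h1 := hasDerivAt_eval_Ht pPsi x
  have h2 := hasDerivAt_eval_Ht pG x
  have h3 := hasDerivAt_eval_Ht (pD pG) x
  have hG := hasDerivAt_Gpot hu
  unfold momentumFlux
  refine ((((((h1.const_mul (-1/2)).mul hζ).mul ((hp.pow 2).add (hr.pow 2))).add
    ((h1.mul hζ).mul hG)).sub ((((h2.const_mul (1/2)).mul hζ).mul hu).mul hr)).add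
    (((h3.const_mul (1/4)).mul hζ).mul (hu.pow 2))).congr_deriv ?_
  have hQ : pQ.eval (Ht x) = 3/2 * (1 - Ht x ^ 2) := by simp [pQ, eval_pW]
  simp only [Nat.cast_ofNat, Nat.add_one_sub_one, pow_one, Pi.pow_apply, Pi.mul_apply,
    Pi.add_apply, momentumRate, momentumSource, Fc, Gpot, Gu, hQ]
  ring

theorem continuous_Gpot {u : ℝ → ℝ} (hu : Continuous u) :
    Continuous fun x => Gpot (Ht x) (u x) := by
  have := continuous_Ht
  unfold Gpot; fun_prop

theorem continuous_Gu {u : ℝ → ℝ} (hu : Continuous u) : Continuous fun x => Gu (Ht x) (u x) := by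
  have := continuous_Ht
  unfold Gu; fun_prop

theorem continuous_eval_Ht (A : ℝ[X]) : Continuous fun x => A.eval (Ht x) :=
  A.continuous.comp continuous_Ht

theorem continuous_Fc {u : ℝ → ℝ} (hu : Continuous u) : Continuous fun x => Fc (Ht x) (u x) := by
  have := continuous_Ht
  have := continuous_eval_Ht (pD (pD pG)); have := continuous_eval_Ht (pD pPsi)
  have := continuous_eval_Ht pQ; have := continuous_eval_Ht pG; have := continuous_eval_Ht pPsi
  unfold Fc; fun_prop

theorem continuous_momentumRate (R : ℝ) {u r p r' p' : ℝ → ℝ} (hu : Continuous u)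
    (hr : Continuous r) (hp : Continuous p) (hr' : Continuous r') (hp' : Continuous p') :
    Continuous (momentumRate R u r p r' p') := by
  have := continuous_eval_Ht pG; have := continuous_eval_Ht pPsi
  have := continuous_Gu hu; have := continuous_cutoff R
  unfold momentumRate; fun_prop

theorem continuous_momentumSource (R : ℝ) {u r p : ℝ → ℝ} (hu : Continuous u)
    (hr : Continuous r) (hp : Continuous p) : Continuous (momentumSource R u r p) := by
  have := continuous_eval_Ht pG; have := continuous_eval_Ht pPsi
  have := continuous_eval_Ht (pD pG); have := continuous_eval_Ht (pD pPsi)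
  have := continuous_Gpot hu; have := continuous_Fc hu
  have := continuous_cutoff R; have := continuous_cutoff' R
  unfold momentumSource; fun_prop

theorem integral_momentumRate {R : ℝ} (hR : 0 < R) {u r p r' p' : ℝ → ℝ}
    (hu : ∀ x, HasDerivAt u (r x) x) (hr : ∀ x, HasDerivAt r (r' x) x)
    (hp : ∀ x, HasDerivAt p (p' x) x) (hr' : Continuous r') (hp' : Continuous p') :
    ∫ x in (-R)..R, momentumRate R u r p r' p' x = ∫ x in (-R)..R, momentumSource R u r p x := by
  have cu : Continuous u := continuous_iff_continuousAt.2 fun x => (hu x).continuousAt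
  have cr : Continuous r := continuous_iff_continuousAt.2 fun x => (hr x).continuousAt
  have cp : Continuous p := continuous_iff_continuousAt.2 fun x => (hp x).continuousAt
  have c1 := continuous_momentumRate R cu cr cp hr' hp'
  have c2 := continuous_momentumSource R cu cr cp
  have h := intervalIntegral.integral_eq_sub_of_hasDerivAt (a := -R) (b := R)
    (fun x _ => hasDerivAt_momentumFlux (R := R) (hu x) (hr x) (hp x))
    ((c1.sub c2).intervalIntegrable _ _)
  rw [intervalIntegral.integral_sub (c1.intervalIntegrable _ _) (c2.intervalIntegrable _ _)] at h
  have e1 : momentumFlux R u r p R = 0 := by simp [momentumFlux, cutoff_self hR]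
  have e2 : momentumFlux R u r p (-R) = 0 := by simp [momentumFlux, cutoff_neg_self hR]
  linarith

/-- Second time derivative of the internal mode coordinate, after integration by parts. -/
noncomputable def modeSource (R : ℝ) (u : ℝ → ℝ) (x : ℝ) : ℝ :=
  (cutoff R x * (pD (pD pY)).eval (Ht x) + 2 * cutoff' R x * (pD pY).eval (Ht x)
    + cutoff'' R x * pY.eval (Ht x)) * u x - cutoff R x * pY.eval (Ht x) * Gu (Ht x) (u x)

theorem continuous_modeSource (R : ℝ) {u : ℝ → ℝ} (hu : Continuous u) :
    Continuous (modeSource R u) := by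
  have := continuous_eval_Ht pY; have := continuous_eval_Ht (pD pY)
  have := continuous_eval_Ht (pD (pD pY)); have := continuous_Gu hu
  have := continuous_cutoff R; have := continuous_cutoff' R; have := continuous_cutoff'' R
  unfold modeSource; fun_prop

theorem integral_mode_eq {R : ℝ} (hR : 0 < R) {u r r' : ℝ → ℝ}
    (hu : ∀ x, HasDerivAt u (r x) x) (hr : ∀ x, HasDerivAt r (r' x) x) (hr' : Continuous r') :
    ∫ x in (-R)..R, cutoff R x * pY.eval (Ht x) * (r' x - Gu (Ht x) (u x)) =
      ∫ x in (-R)..R, modeSource R u x := by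
  have cu : Continuous u := continuous_iff_continuousAt.2 fun x => (hu x).continuousAt
  have c1 : Continuous fun x => cutoff R x * pY.eval (Ht x) * (r' x - Gu (Ht x) (u x)) := by
    have := continuous_eval_Ht pY; have := continuous_Gu cu; have := continuous_cutoff R
    fun_prop
  have c2 := continuous_modeSource R cu
  obtain ⟨W, hW⟩ : ∃ W : ℝ → ℝ, W = fun x => cutoff R x * pY.eval (Ht x) * r x
    - (cutoff' R x * pY.eval (Ht x) + cutoff R x * (pD pY).eval (Ht x)) * u x := ⟨_, rfl⟩
  have hd (x) : HasDerivAt W (cutoff R x * pY.eval (Ht x) * (r' x - Gu (Ht x) (u x))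
      - modeSource R u x) x := by
    have hζ := hasDerivAt_cutoff R x
    have hζ' := hasDerivAt_cutoff' R x
    have h1 := hasDerivAt_eval_Ht pY x
    have h2 := hasDerivAt_eval_Ht (pD pY) x
    rw [hW]
    refine (((hζ.mul h1).mul (hr x)).sub (((hζ'.mul h1).add (hζ.mul h2)).mul (hu x))).congr_deriv ?_
    simp only [Pi.mul_apply, Pi.add_apply, modeSource]
    ring
  have h := intervalIntegral.integral_eq_sub_of_hasDerivAt (a := -R) (b := R) (fun x _ => hd x)
    ((c1.sub c2).intervalIntegrable _ _)
  rw [intervalIntegral.integral_sub (c1.intervalIntegrable _ _) (c2.intervalIntegrable _ _)] at h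
  have e1 : W R = 0 := by simp [hW, cutoff_self hR, cutoff'_self hR]
  have e2 : W (-R) = 0 := by simp [hW, cutoff_neg_self hR, cutoff'_neg_self hR]
  linarith

theorem abs_mul_le_mul {a b A B : ℝ} (ha : |a| ≤ A) (hb : |b| ≤ B) : |a * b| ≤ A * B := by
  rw [abs_mul]; exact mul_le_mul ha hb (abs_nonneg _) ((abs_nonneg _).trans ha)

theorem pow_four_mul_abs_le {w u : ℝ} (hw0 : 0 ≤ w) (hw1 : w ≤ 1) :
    w ^ 4 * |u| ≤ 1/2 * (w ^ 2 * u ^ 2 + w ^ 2) := by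
  have h1 : w ^ 4 * |u| ≤ w ^ 2 * |u| :=
    mul_le_mul_of_nonneg_right (pow_le_pow_of_le_one hw0 hw1 (by norm_num)) (abs_nonneg u)
  have h2 : 0 ≤ w ^ 2 * (|u| - 1) ^ 2 := by positivity
  have h3 := sq_abs u
  have h4 : w ^ 2 * (|u| - 1) ^ 2 = w ^ 2 * u ^ 2 - 2 * (w ^ 2 * |u|) + w ^ 2 := by
    rw [← h3]; ring
  linarith

theorem cutoff_error_lower {e K w ζ' ζ'' ψ G g dg dY Y af f u v r p κ z : ℝ}
    (hw0 : 0 ≤ w) (hw1 : w ≤ 1) (he : 0 ≤ e) (hK : 1 ≤ K) (hζ' : |ζ'| ≤ 4 * e)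
    (hζ'' : |ζ''| ≤ 8 * e) (hψζ : ψ * ζ' ≤ 0) (hψ : |ψ| ≤ K) (hG : -(9/8 * (w ^ 2 * u ^ 2)) ≤ G)
    (hg : |g| ≤ K * w) (hdg : |dg| ≤ K * w ^ 2) (hdY : |dY| ≤ K * w ^ 4) (hY : |Y| ≤ K * w ^ 4)
    (haf : |af| ≤ K * w ^ 4) (hf : |f| ≤ K) (hκ : |κ| ≤ 1) (hz : |z| ≤ 1) (hv : v = u - κ * f) :
    -(20 * K ^ 2 * e * (p ^ 2 + r ^ 2 + w ^ 2 * u ^ 2 + w ^ 2)) ≤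
      ζ' * (1/2 * ψ * (p ^ 2 + r ^ 2) - ψ * G + 1/2 * g * u * r - 1/4 * dg * u ^ 2)
        + z * ((2 * ζ' * dY + ζ'' * Y) * u) - 2 * κ * ζ' * af * v := by
  have hK0 : 0 ≤ K := by linarith
  have hψζ' : -(4 * e * K) ≤ ψ * ζ' := by
    have := (abs_le.1 (abs_mul_le_mul hζ' hψ)).1; linarith
  have t1 : -(2 * e * K * (p ^ 2 + r ^ 2)) ≤ 1/2 * (ψ * ζ') * (p ^ 2 + r ^ 2) := by
    have := mul_le_mul_of_nonneg_right hψζ' (by positivity : 0 ≤ p ^ 2 + r ^ 2)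
    linarith
  have t2 : -(9/2 * e * K * (w ^ 2 * u ^ 2)) ≤ -(ψ * ζ') * G := by
    have h1 := mul_le_mul_of_nonneg_left hG (by linarith : 0 ≤ -(ψ * ζ'))
    have h2 := mul_le_mul_of_nonneg_right hψζ' (by positivity : 0 ≤ w ^ 2 * u ^ 2)
    linarith
  have t3 : |ζ' * g * (u * r)| ≤ 4 * e * K * (1/2 * (w ^ 2 * u ^ 2 + r ^ 2)) := by
    have h1 := abs_mul_le_mul (abs_mul_le_mul hζ' hg) (le_refl |u * r|)
    have h2 := abs_mul_abs_le (w * u) r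
    rw [abs_mul w, abs_of_nonneg hw0] at h2
    have h3 := mul_le_mul_of_nonneg_left h2 (by positivity : 0 ≤ 4 * e * K)
    rw [abs_mul u] at h1
    linarith
  have t4 : |ζ' * dg * u ^ 2| ≤ 4 * e * (K * w ^ 2) * u ^ 2 :=
    (abs_mul_le_mul (abs_mul_le_mul hζ' hdg) (le_of_eq (abs_of_nonneg (sq_nonneg u))))
  have hu4 := pow_four_mul_abs_le (u := u) hw0 hw1
  have t5 : |z * ((2 * ζ' * dY + ζ'' * Y) * u)| ≤ 16 * e * K * (1/2 * (w ^ 2 * u ^ 2 + w ^ 2)) := by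
    have h1 : |2 * ζ' * dY + ζ'' * Y| ≤ 16 * e * (K * w ^ 4) := by
      refine (abs_add_le _ _).trans ?_
      have := abs_mul_le_mul hζ' hdY
      have := abs_mul_le_mul hζ'' hY
      rw [mul_assoc, abs_mul, abs_two]; linarith
    have h2 := abs_mul_le_mul hz (abs_mul_le_mul h1 (le_refl |u|))
    have h3 := mul_le_mul_of_nonneg_left hu4 (by positivity : 0 ≤ 16 * e * K)
    linarith
  have t6 : |κ * (ζ' * af) * v| ≤
      4 * e * K * (1/2 * (w ^ 2 * u ^ 2 + w ^ 2)) + 4 * e * K ^ 2 * w ^ 2 := by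
    have h0 : |v| ≤ |u| + K := by
      rw [hv]
      have := abs_mul_le_mul hκ hf
      exact (abs_sub _ _).trans (by linarith)
    have h1 := abs_mul_le_mul (abs_mul_le_mul hκ (abs_mul_le_mul hζ' haf)) h0
    have h2 := mul_le_mul_of_nonneg_left hu4 (by positivity : 0 ≤ 4 * e * K)
    have h3 : 4 * e * K ^ 2 * w ^ 4 ≤ 4 * e * K ^ 2 * w ^ 2 :=
      mul_le_mul_of_nonneg_left (pow_le_pow_of_le_one hw0 hw1 (by norm_num)) (by positivity)
    linarith
  have hKK : K ≤ K ^ 2 := by nlinarith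
  have hKe : K * e ≤ K ^ 2 * e := mul_le_mul_of_nonneg_right hKK he
  have s1 := mul_le_mul_of_nonneg_right hKe (sq_nonneg p)
  have s2 := mul_le_mul_of_nonneg_right hKe (sq_nonneg r)
  have s3 := mul_le_mul_of_nonneg_right hKe (by positivity : 0 ≤ w ^ 2 * u ^ 2)
  have s4 := mul_le_mul_of_nonneg_right hKe (sq_nonneg w)
  have q1 : 0 ≤ K * e * p ^ 2 := by positivity
  have q2 : 0 ≤ K * e * r ^ 2 := by positivity
  have q3 : 0 ≤ K * e * (w ^ 2 * u ^ 2) := by positivity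
  have q4 : 0 ≤ K * e * w ^ 2 := by positivity
  have := (abs_le.1 t3).1
  have := (abs_le.1 t4).2
  have := (abs_le.1 t5).1
  have := (abs_le.1 t6).2
  linarith

theorem density_lower {η : ℝ} (hη : 0 < η) : ∃ ε > 0, ∃ c > 0, ∃ C : ℝ, 0 ≤ C ∧
    ∀ (R x κ z : ℝ) (u r p : ℝ → ℝ), 1 ≤ R → |x| ≤ R → |κ| ≤ 1 → |z| ≤ ε → |z| ≤ 1 →
    (1 - Ht x ^ 2) * u x ^ 2 ≤ ε ^ 2 →
    c * (cutoff R x * ((1 - Ht x ^ 2) ^ 4 * (p x ^ 2 + r x ^ 2 + u x ^ 2)))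
      + (κ ^ 2 * pP11.eval (Ht x) + κ * z * pP12.eval (Ht x) + z ^ 2 * pP22.eval (Ht x))
      - η * (κ ^ 2 + z ^ 2) * (1 - Ht x ^ 2) ^ 2
      - C / R * (p x ^ 2 + r x ^ 2 + Qt x ^ 2 * u x ^ 2 + (1 - Ht x ^ 2) ^ 2)
      + (6/5 * z - 5/4 * κ) * (cutoff R x * pY.eval (Ht x) * u x) ≤
    momentumSource R u r p x + z * modeSource R u x - virialDensity R κ u r x := by
  obtain ⟨ε, hε, c, hc, hst⟩ := staticDensity_lower η hη
  obtain ⟨K, hK1, hK⟩ := exists_common_bound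
    [(pPsi, 0), (pG, 1), (pD pG, 2), (pD pY, 4), (pY, 4), (pA * pD pF, 4), (pF, 0),
      (pP11, 3), (pP12, 3), (pP22, 3)] (by
    have d1 : pW ^ 4 ∣ pD pY := dvd_of_le (by norm_num) (pW_pow_dvd_pD dvd_pY)
    have d2 : pW ^ 4 ∣ pA * pD pF := dvd_mul' le_rfl dvd_pA dvd_pD_pF
    have d3 : pW ^ 1 ∣ pG := dvd_of_le (by norm_num) dvd_pG
    simpa [pow_zero] using ⟨by simpa using d3, pW_sq_dvd_pD _, d1, dvd_pY, d2, dvd_pP11, dvd_pP12,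
      dvd_pP22⟩)
  simp only [List.forall_mem_cons, pow_zero, pow_one, mul_one] at hK
  obtain ⟨kψ, kg, kdg, kdY, kY, kaf, kf, k11, k12, k22, -⟩ := hK
  refine ⟨ε, hε, min c (1/1000), by positivity, 20 * K ^ 2 + 8 * K, by positivity,
    fun R x κ z u r p hR hx hκ hz hz1 hu => ?_⟩
  have hR0 : 0 < R := by linarith
  have hh := abs_Ht_lt_one x
  have hw := one_sub_Ht_sq_pos x
  have hw1 : 1 - Ht x ^ 2 ≤ 1 := by linarith [sq_nonneg (Ht x)]
  have hQ := Qt_eq x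
  have hψ' := eval_pD_pPsi_lower (Ht x)
  have hcut := one_sub_cutoff_mul_le hR0 hx
  have hζ0 := cutoff_nonneg R x
  have hζ1 := cutoff_le_one hR0 hx
  obtain ⟨e, he⟩ : ∃ e, e = 1 / R := ⟨_, rfl⟩
  have he0 : 0 ≤ e := he ▸ by positivity
  have hψζ : pPsi.eval (Ht x) * cutoff' R x ≤ 0 := by
    refine mul_cutoff'_nonpos hR0 hx ?_
    have e1 : pPsi.eval (Ht x) = Ht x * (1 + Ht x ^ 2 + 4 * Ht x ^ 4) := by simp [pPsi]; ring
    rw [e1, ← mul_assoc]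
    refine mul_nonneg ?_ (by positivity)
    rcases le_total 0 x with h | h
    · exact mul_nonneg h (Ht_nonneg h)
    · exact mul_nonneg_of_nonpos_of_nonpos h (Ht_nonpos h)
  have hst := hst (Ht x) κ z (u x - κ * pF.eval (Ht x)) hh
    (by rw [add_sub_cancel]; exact hu) hz
  rw [add_sub_cancel] at hst
  obtain ⟨w, hwe⟩ : ∃ w, w = 1 - Ht x ^ 2 := ⟨_, rfl⟩
  have hG : -(9/8 * (w ^ 2 * u x ^ 2)) ≤ Gpot (Ht x) (u x) := by
    rw [Gpot, ← hwe]
    rw [← hwe] at hw hw1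
    have h1 : 0 ≤ 9/16 * w ^ 2 * u x ^ 2 * (2 * Ht x + u x) ^ 2 := by positivity
    have h2 : w ^ 3 * u x ^ 2 ≤ w ^ 2 * u x ^ 2 :=
      mul_le_mul_of_nonneg_right (pow_le_pow_of_le_one hw.le hw1 (by norm_num)) (sq_nonneg _)
    linarith
  have kψ := kψ _ hh; have kg := kg _ hh; have kdg := kdg _ hh; have kdY := kdY _ hh
  have kY := kY _ hh; have kaf := kaf _ hh; have kf := kf _ hh; have k11 := k11 _ hh
  have k12 := k12 _ hh; have k22 := k22 _ hh
  rw [← hwe] at hw hw1 hcut hψ' hst hQ kg kdg kdY kY kaf k11 k12 k22 ⊢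
  have herr := cutoff_error_lower (p := p x) (r := r x) (u := u x) hw.le hw1 he0 hK1
    ((abs_cutoff'_le hR0 hx).trans_eq (by rw [he]; ring))
    ((abs_cutoff''_le hR hx).trans_eq (by rw [he]; ring)) hψζ kψ hG kg kdg kdY kY kaf kf
    hκ hz1 rfl
  have hP {k P : ℝ} (hk : |k| ≤ 1) (hP : |P| ≤ K * w ^ 3) :
      k * P - 8/3 * e * K * w ^ 2 ≤ cutoff R x * (k * P) := by
    have h1 : |(1 - cutoff R x) * (k * P)| ≤ (1 - cutoff R x) * (1 * (K * w ^ 3)) :=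
      abs_mul_le_mul (le_of_eq (abs_of_nonneg (by linarith))) (abs_mul_le_mul hk hP)
    have h2 := mul_le_mul_of_nonneg_right hcut (by positivity : 0 ≤ K * w ^ 2)
    rw [div_eq_mul_one_div, ← he] at h2
    linarith [(abs_le.1 h1).2]
  have hκ2 : |κ ^ 2| ≤ 1 := by rw [abs_pow]; exact pow_le_one₀ (abs_nonneg _) hκ
  have hz2 : |z ^ 2| ≤ 1 := by rw [abs_pow]; exact pow_le_one₀ (abs_nonneg _) hz1
  have hκz : |κ * z| ≤ 1 := (abs_mul_le_mul hκ hz1).trans_eq (one_mul 1)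
  have p1 := hP hκ2 k11
  have p2 := hP hκz k12
  have p3 := hP hz2 k22
  have hηw : cutoff R x * (η * w ^ 2 * (κ ^ 2 + z ^ 2)) ≤ η * w ^ 2 * (κ ^ 2 + z ^ 2) :=
    mul_le_of_le_one_left (by positivity) hζ1
  have hst' := mul_le_mul_of_nonneg_left hst hζ0
  have hw42 : w ^ 4 ≤ w ^ 2 := pow_le_pow_of_le_one hw.le hw1 (by norm_num)
  obtain ⟨c', hc'⟩ : ∃ c', c' = min c (1/1000) := ⟨_, rfl⟩
  have hc1 : c' ≤ c := hc' ▸ min_le_left _ _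
  have hc2 : c' ≤ 1/1000 := hc' ▸ min_le_right _ _
  rw [← hc']
  have m1 : c' * (cutoff R x * (w ^ 4 * u x ^ 2)) ≤ c * (cutoff R x * (w ^ 4 * u x ^ 2)) :=
    mul_le_mul_of_nonneg_right hc1 (by positivity)
  have m2 (y : ℝ) : c' * (cutoff R x * (w ^ 4 * y ^ 2)) ≤
      cutoff R x * (1/200 * (pD pPsi).eval (Ht x) * y ^ 2) := by
    have h1 : c' * w ^ 4 ≤ 1/1000 * w ^ 2 := mul_le_mul hc2 hw42 (by positivity) (by norm_num)
    have h2 : c' * w ^ 4 ≤ 1/200 * (pD pPsi).eval (Ht x) := by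
      have : 0 ≤ w ^ 2 := by positivity
      linarith
    have := mul_le_mul_of_nonneg_right h2 (by positivity : 0 ≤ cutoff R x * y ^ 2)
    linarith
  have m3 : 0 ≤ cutoff R x * ((pD pPsi).eval (Ht x) * p x ^ 2) := by
    have : 0 ≤ (pD pPsi).eval (Ht x) := le_trans (by positivity) hψ'
    positivity
  have m4 := m2 (p x)
  have m5 := m2 (r x)
  have hCR : (20 * K ^ 2 + 8 * K) / R = (20 * K ^ 2 + 8 * K) * e := by rw [he]; ring
  have hQu : w ^ 2 * u x ^ 2 ≤ Qt x ^ 2 * u x ^ 2 := by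
    rw [hQ]
    have : 0 ≤ w ^ 2 * u x ^ 2 := by positivity
    linarith
  have n1 := mul_le_mul_of_nonneg_left hQu (by positivity : 0 ≤ 20 * K ^ 2 * e)
  have n2 : 0 ≤ 8 * K * e * (p x ^ 2 + r x ^ 2 + Qt x ^ 2 * u x ^ 2) := by positivity
  have hid : momentumSource R u r p x + z * modeSource R u x - virialDensity R κ u r x
      = (cutoff R x * (1/20 * (pD pPsi).eval (Ht x) * p x ^ 2
          + 1/200 * (pD pPsi).eval (Ht x) * r x ^ 2)
        + cutoff R x * staticDensity (Ht x) κ z (u x - κ * pF.eval (Ht x))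
        + (6/5 * z - 5/4 * κ) * (cutoff R x * pY.eval (Ht x) * u x))
        + (cutoff' R x * (1/2 * pPsi.eval (Ht x) * (p x ^ 2 + r x ^ 2)
            - pPsi.eval (Ht x) * Gpot (Ht x) (u x) + 1/2 * pG.eval (Ht x) * u x * r x
            - 1/4 * (pD pG).eval (Ht x) * u x ^ 2)
          + z * ((2 * cutoff' R x * (pD pY).eval (Ht x) + cutoff'' R x * pY.eval (Ht x)) * u x)
          - 2 * κ * cutoff' R x * (pA * pD pF).eval (Ht x)
            * (u x - κ * pF.eval (Ht x))) := by
    have eG : pG.eval (Ht x) = 9/10 * (pD pPsi).eval (Ht x) := by simp [pG]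
    simp only [momentumSource, modeSource, virialDensity, staticDensity, add_sub_cancel, eval_pA,
      eG]
    ring
  rw [hid, hCR]
  linarith

theorem exists_lipschitz_bound (A : ℝ[X]) : ∃ K : ℝ, 0 ≤ K ∧
    ∀ a ∈ Set.Icc (-1 : ℝ) 1, ∀ b ∈ Set.Icc (-1 : ℝ) 1, |A.eval b - A.eval a| ≤ K * |b - a| := by
  obtain ⟨K, hK⟩ := isCompact_Icc.exists_bound_of_continuousOn (s := Set.Icc (-1 : ℝ) 1)
    (f := fun h => (derivative A).eval h) (derivative A).continuous.continuousOn
  refine ⟨K, (norm_nonneg _).trans (hK 0 (by norm_num)), fun a ha b hb => ?_⟩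
  exact (convex_Icc (-1 : ℝ) 1).norm_image_sub_le_of_norm_hasDerivWithin_le
    (fun x _ => (A.hasDerivAt x).hasDerivWithinAt) hK ha hb

theorem exists_integral_eval_Ht_bound {A B : ℝ[X]} (h : ∀ x, (pD A).eval x = B.eval x) :
    ∃ K : ℝ, 0 ≤ K ∧ ∀ R : ℝ, 1 ≤ R →
      |(∫ x in (-R)..R, B.eval (Ht x)) - (A.eval 1 - A.eval (-1))| ≤ K / R := by
  obtain ⟨K, hK0, hK⟩ := exists_lipschitz_bound A
  refine ⟨8/3 * K, by positivity, fun R hR => ?_⟩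
  have hR0 : 0 < R := by linarith
  have hw {x : ℝ} (hx : |x| = R) : 1 - Ht x ^ 2 ≤ 4/3 / R := by
    rw [le_div_iff₀ hR0, mul_comm, ← hx]; exact abs_mul_one_sub_Ht_sq_le x
  have b1 := abs_lt.1 (abs_Ht_lt_one R)
  have b2 := abs_lt.1 (abs_Ht_lt_one (-R))
  have p1 := Ht_nonneg hR0.le
  have p2 := Ht_nonpos (by linarith : -R ≤ 0)
  have w1 := hw (abs_of_pos hR0)
  have w2 := hw (by rw [abs_neg, abs_of_pos hR0] : |-R| = R)
  have k1 := hK (Ht R) ⟨b1.1.le, b1.2.le⟩ 1 (by norm_num)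
  have k2 := hK (Ht (-R)) ⟨b2.1.le, b2.2.le⟩ (-1) (by norm_num)
  have m1 : |1 - Ht R| ≤ 4/3 / R := by
    rw [abs_of_nonneg (by linarith)]; nlinarith
  have m2 : |-1 - Ht (-R)| ≤ 4/3 / R := by
    rw [abs_of_nonpos (by linarith)]; nlinarith
  have k1' := abs_le.1 (k1.trans (mul_le_mul_of_nonneg_left m1 hK0))
  have k2' := abs_le.1 (k2.trans (mul_le_mul_of_nonneg_left m2 hK0))
  have e : ∫ x in (-R)..R, B.eval (Ht x) = A.eval (Ht R) - A.eval (Ht (-R)) := by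
    rw [← integral_eval_pD]; exact intervalIntegral.integral_congr fun x _ => (h _).symm
  have e2 : 8/3 * K / R = K * (4/3 / R) + K * (4/3 / R) := by ring
  rw [e, e2, abs_le]
  constructor <;> linarith [k1'.1, k1'.2, k2'.1, k2'.2]

/-- Localized coordinate along the internal mode. -/
noncomputable def modeCoord (R : ℝ) (u : ℝ → ℝ) : ℝ :=
  ∫ x in (-R)..R, cutoff R x * pY.eval (Ht x) * u x

noncomputable def momentum (R : ℝ) (u r p : ℝ → ℝ) : ℝ :=
  ∫ x in (-R)..R, -(pPsi.eval (Ht x) * cutoff R x * r x + 1/2 * pG.eval (Ht x) * cutoff R x * u x)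
    * p x

theorem intervalIntegral_sq_le {f : ℝ → ℝ} {ε : ℝ} (hf : Integrable fun x => f x ^ 2)
    (h : ∫ x, f x ^ 2 ≤ ε ^ 2) (a b : ℝ) : ∫ x in a..b, f x ^ 2 ≤ ε ^ 2 :=
  (le_abs_self _).trans ((abs_intervalIntegral_le_integral hf (fun _ => sq_nonneg _) a b).trans h)

theorem Qt_sq_mul_sq (f : ℝ → ℝ) :
    (fun x => Qt x ^ 2 * f x ^ 2) = fun x => (Qt x * f x) ^ 2 := by
  funext x; ring

theorem continuous_Qt : Continuous Qt := by
  have := continuous_Ht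
  rw [show Qt = _ from funext Qt_eq]; fun_prop

theorem abs_intervalIntegral_le_of_abs_le {a b : ℝ} (hab : a ≤ b) {f g : ℝ → ℝ}
    (hg : Continuous g) (h : ∀ x ∈ Set.Icc a b, |f x| ≤ g x) :
    |∫ x in a..b, f x| ≤ ∫ x in a..b, g x := by
  rw [← Real.norm_eq_abs]
  exact intervalIntegral.norm_integral_le_of_norm_le hab
    (Eventually.of_forall fun x hx => h x (Set.Ioc_subset_Icc_self hx))
    (hg.intervalIntegrable _ _)

theorem exists_modeCoord_small : ∃ K > 0, ∀ (R S : ℝ) (u : ℝ → ℝ), 0 < R → 0 ≤ S →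
    (∀ x, (1 - Ht x ^ 2) * u x ^ 2 ≤ S ^ 2) → |modeCoord R u| ≤ K * S := by
  obtain ⟨K, hK1, hK⟩ := exists_common_bound [(pY, 4)] (by simpa using dvd_pY)
  simp only [List.forall_mem_cons] at hK
  refine ⟨8/3 * K, by positivity, fun R S u hR hS hu => ?_⟩
  have hw2 : Continuous fun x => K * S * (1 - Ht x ^ 2) ^ 2 := by
    have := continuous_Ht; fun_prop
  refine (abs_intervalIntegral_le_of_abs_le (by linarith) hw2 fun x hx => ?_).trans ?_
  · have hw := one_sub_Ht_sq_pos x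
    have hw1 : 1 - Ht x ^ 2 ≤ 1 := by linarith [sq_nonneg (Ht x)]
    have h1 := hK.1 _ (abs_Ht_lt_one x)
    have h2 : |(1 - Ht x ^ 2) * u x| ≤ S := by
      refine abs_le_of_sq_le_sq ?_ hS
      have := mul_le_of_le_one_left (mul_nonneg hw.le (sq_nonneg (u x))) hw1
      linarith [hu x]
    have hζ1 := cutoff_le_one hR (abs_le.2 hx)
    have h3 : |cutoff R x| ≤ 1 := by rwa [abs_of_nonneg (cutoff_nonneg R x)]
    rw [abs_mul, abs_of_pos hw] at h2
    calc _ ≤ 1 * (K * (1 - Ht x ^ 2) ^ 4) * |u x| :=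
          abs_mul_le_mul (abs_mul_le_mul h3 h1) le_rfl
      _ = K * (1 - Ht x ^ 2) ^ 3 * ((1 - Ht x ^ 2) * |u x|) := by ring
      _ ≤ K * (1 - Ht x ^ 2) ^ 2 * S := by
          refine mul_le_mul (mul_le_mul_of_nonneg_left ?_ (by linarith)) h2 (by positivity)
            (by positivity)
          exact pow_le_pow_of_le_one hw.le hw1 (by norm_num)
      _ = _ := by ring
  · rw [intervalIntegral.integral_const_mul]
    have := mul_le_mul_of_nonneg_left (integral_weight_le (-R) R) (by positivity : 0 ≤ K * S)
    linarith

/-- Fixed-time hypotheses: a state with derivatives and energy norm at most `ε`. -/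
structure IsState (ε : ℝ) (u r p r' p' : ℝ → ℝ) : Prop where
  hu : ∀ x, HasDerivAt u (r x) x
  hr : ∀ x, HasDerivAt r (r' x) x
  hp : ∀ x, HasDerivAt p (p' x) x
  hr' : Continuous r'
  hp' : Continuous p'
  integrable_r : Integrable fun x => r x ^ 2
  integrable_u : Integrable fun x => Qt x ^ 2 * u x ^ 2
  integrable_p : Integrable fun x => p x ^ 2
  integral_r : ∫ x, r x ^ 2 ≤ ε ^ 2
  integral_u : ∫ x, Qt x ^ 2 * u x ^ 2 ≤ ε ^ 2
  integral_p : ∫ x, p x ^ 2 ≤ ε ^ 2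

namespace IsState

variable {ε : ℝ} {u r p r' p' : ℝ → ℝ}

theorem continuous_u (h : IsState ε u r p r' p') : Continuous u :=
  continuous_iff_continuousAt.2 fun x => (h.hu x).continuousAt
theorem continuous_r (h : IsState ε u r p r' p') : Continuous r :=
  continuous_iff_continuousAt.2 fun x => (h.hr x).continuousAt
theorem continuous_p (h : IsState ε u r p r' p') : Continuous p :=
  continuous_iff_continuousAt.2 fun x => (h.hp x).continuousAt

theorem integral_energy_le (h : IsState ε u r p r' p') (a b : ℝ) :
    ∫ x in a..b, (p x ^ 2 + r x ^ 2 + Qt x ^ 2 * u x ^ 2 + (1 - Ht x ^ 2) ^ 2) ≤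
      3 * ε ^ 2 + 8/3 := by
  have cp := h.continuous_p; have cr := h.continuous_r; have cu := h.continuous_u
  have cQ := continuous_Qt; have cH := continuous_Ht
  have i {f : ℝ → ℝ} (hf : Continuous f) : IntervalIntegrable f volume a b :=
    hf.intervalIntegrable a b
  rw [intervalIntegral.integral_add (i (by fun_prop)) (i (by fun_prop)),
    intervalIntegral.integral_add (i (by fun_prop)) (i (by fun_prop)),
    intervalIntegral.integral_add (i (by fun_prop)) (i (by fun_prop))]
  have hu := h.integral_u
  have hiu := h.integrable_u
  rw [Qt_sq_mul_sq] at hiu hu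
  have b1 := intervalIntegral_sq_le h.integrable_p h.integral_p a b
  have b2 := intervalIntegral_sq_le h.integrable_r h.integral_r a b
  have b3 := intervalIntegral_sq_le hiu hu a b
  rw [← Qt_sq_mul_sq] at b3
  have b4 := integral_weight_le a b
  linarith

end IsState

theorem integral_combination {a b : ℝ} {f g₁ g₂ g₃ k l m : ℝ → ℝ} (hf : Continuous f)
    (h₁ : Continuous g₁) (h₂ : Continuous g₂) (h₃ : Continuous g₃) (hk : Continuous k)
    (hl : Continuous l) (hm : Continuous m) (c c₁ c₂ c₃ d e n : ℝ) :
    ∫ x in a..b, (c * f x + (c₁ * g₁ x + c₂ * g₂ x + c₃ * g₃ x) - d * k x - e * l x + n * m x) =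
      c * (∫ x in a..b, f x) + (c₁ * (∫ x in a..b, g₁ x) + c₂ * (∫ x in a..b, g₂ x)
        + c₃ * (∫ x in a..b, g₃ x)) - d * (∫ x in a..b, k x) - e * (∫ x in a..b, l x)
        + n * ∫ x in a..b, m x := by
  have i {f : ℝ → ℝ} (hf : Continuous f) : IntervalIntegrable f volume a b :=
    hf.intervalIntegrable a b
  rw [intervalIntegral.integral_add (i (by fun_prop)) (i (by fun_prop)),
    intervalIntegral.integral_sub (i (by fun_prop)) (i (by fun_prop)),
    intervalIntegral.integral_sub (i (by fun_prop)) (i (by fun_prop)),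
    intervalIntegral.integral_add (i (by fun_prop)) (i (by fun_prop)),
    intervalIntegral.integral_add (i (by fun_prop)) (i (by fun_prop)),
    intervalIntegral.integral_add (i (by fun_prop)) (i (by fun_prop))]
  simp only [intervalIntegral.integral_const_mul]

/-- Localized coercivity of the virial functional. -/
theorem exists_virial_lower_bound : ∃ ε > 0, ∃ c > 0, ∃ C : ℝ, 0 ≤ C ∧
    ∀ (R : ℝ) (u r p r' p' : ℝ → ℝ), 1 ≤ R → IsState ε u r p r' p' →
    c * (∫ x in (-R)..R, cutoff R x * ((1 - Ht x ^ 2) ^ 4 * (p x ^ 2 + r x ^ 2 + u x ^ 2)))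
      - C / R ≤ (∫ x in (-R)..R, momentumRate R u r p r' p' x) + (modeCoord R p ^ 2
        + modeCoord R u * modeCoord R fun x => r' x - Gu (Ht x) (u x)) := by
  obtain ⟨ε, hε, c, hc, C, hC, hden⟩ := density_lower (η := 1/1000) (by norm_num)
  obtain ⟨C₁, hC₁, hsup⟩ := exists_weighted_sup_bound
  obtain ⟨K, hK, hmode⟩ := exists_modeCoord_small
  obtain ⟨K₁, hK₁, hM₁⟩ := exists_integral_eval_Ht_bound eval_pD_pM11
  obtain ⟨K₂, hK₂, hM₂⟩ := exists_integral_eval_Ht_bound eval_pD_pM12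
  obtain ⟨K₃, hK₃, hM₃⟩ := exists_integral_eval_Ht_bound eval_pD_pM22
  obtain ⟨δ, hδ⟩ : ∃ δ, δ = min (1/2) (min ε (min (ε / K) (1 / K))) / C₁ := ⟨_, rfl⟩
  have hδ0 : 0 < δ := hδ ▸ by positivity
  have hδ' : C₁ * δ = min (1/2) (min ε (min (ε / K) (1 / K))) := by
    rw [hδ]; field_simp
  have hS1 : C₁ * δ ≤ 1/2 := hδ' ▸ min_le_left _ _
  have hS2 : C₁ * δ ≤ ε := hδ' ▸ (min_le_right _ _).trans (min_le_left _ _)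
  have hS3 : C₁ * δ ≤ ε / K :=
    hδ' ▸ (min_le_right _ _).trans ((min_le_right _ _).trans (min_le_left _ _))
  have hS4 : C₁ * δ ≤ 1 / K :=
    hδ' ▸ (min_le_right _ _).trans ((min_le_right _ _).trans (min_le_right _ _))
  rw [le_div_iff₀ hK, mul_comm] at hS3 hS4
  refine ⟨δ, hδ0, c, hc, C * (3 * δ ^ 2 + 8/3) + (K₁ + K₂ + K₃), by positivity,
    fun R u r p r' p' hR hst => ?_⟩
  have hR0 : 0 < R := by linarith
  have cu := hst.continuous_u
  have cr := hst.continuous_r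
  have cp := hst.continuous_p
  have hS0 : 0 ≤ C₁ * δ := by positivity
  have hwu := hsup u r δ hst.hu cr hst.integrable_r hst.integrable_u hst.integral_r hst.integral_u
  obtain ⟨z, hz⟩ : ∃ z, z = modeCoord R u := ⟨_, rfl⟩
  obtain ⟨κ, hκ⟩ : ∃ κ, κ = 2 * u 0 := ⟨_, rfl⟩
  have hzS := hmode R _ u hR0 hS0 hwu
  rw [← hz] at hzS
  have hκ1 : |κ| ≤ 1 := by
    have h0 := hwu 0
    rw [Ht_zero] at h0
    have := abs_le_of_sq_le_sq (by linarith : u 0 ^ 2 ≤ (C₁ * δ) ^ 2) hS0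
    rw [hκ, abs_mul, abs_two]; linarith
  have hκF : u 0 = κ * pF.eval 0 := by
    rw [hκ]; simp [pF, pW]; ring
  have hpt := fun x (hx : x ∈ Set.Icc (-R) R) => hden R x κ z u r p hR (abs_le.2 hx) hκ1
    (hzS.trans hS3) (hzS.trans hS4)
    ((hwu x).trans (pow_le_pow_left₀ hS0 hS2 2))
  have cH := continuous_Ht
  have cQ := continuous_Qt
  have cζ := continuous_cutoff R
  have cζ' := continuous_cutoff' R
  have cY := continuous_eval_Ht pY
  have c1 : Continuous fun x =>
    cutoff R x * ((1 - Ht x ^ 2) ^ 4 * (p x ^ 2 + r x ^ 2 + u x ^ 2)) := by fun_prop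
  have c2 := continuous_eval_Ht pP11
  have c3 := continuous_eval_Ht pP12
  have c4 := continuous_eval_Ht pP22
  have c5 : Continuous fun x => (1 - Ht x ^ 2) ^ 2 := by fun_prop
  have c6 : Continuous fun x => p x ^ 2 + r x ^ 2 + Qt x ^ 2 * u x ^ 2 + (1 - Ht x ^ 2) ^ 2 := by
    fun_prop
  have c7 : Continuous fun x => cutoff R x * pY.eval (Ht x) * u x := by fun_prop
  have c8 := continuous_momentumSource R cu cr cp
  have c9 := continuous_modeSource R cu
  have c10 : Continuous (virialDensity R κ u r) := by
    have := continuous_eval_Ht pA; have := continuous_eval_Ht (pA * pD pF ^ 2)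
    have := continuous_eval_Ht pE; have := continuous_eval_Ht pF
    have := continuous_eval_Ht (pD (pA * pD pF)); have := continuous_eval_Ht (pA * pD pF)
    unfold virialDensity
    fun_prop
  have i {f : ℝ → ℝ} (hf : Continuous f) : IntervalIntegrable f volume (-R) R :=
    hf.intervalIntegrable _ _
  have hint := intervalIntegral.integral_mono_on (by linarith : -R ≤ R)
    (i (by fun_prop)) (i (by fun_prop)) hpt
  rw [integral_combination c1 c2 c3 c4 c5 c6 c7,
    intervalIntegral.integral_sub (i (by fun_prop)) (i c10),
    intervalIntegral.integral_add (i c8) (i (by fun_prop)), intervalIntegral.integral_const_mul,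
    ← integral_momentumRate hR0 hst.hu hst.hr hst.hp hst.hr' hst.hp',
    ← integral_mode_eq hR0 hst.hu hst.hr hst.hr'] at hint
  have hvir := integral_virialDensity_nonneg hR0 hst.hu cr hκF
  have hE := mul_le_mul_of_nonneg_left (hst.integral_energy_le (-R) R)
    (by positivity : 0 ≤ C / R)
  have hW := mul_le_mul_of_nonneg_left (integral_weight_le (-R) R)
    (by positivity : 0 ≤ 1/1000 * (κ ^ 2 + z ^ 2))
  have hz1 := hzS.trans hS4
  have q := quadratic_form_lower κ z
  have bd {k I m K : ℝ} (hk : |k| ≤ 1) (h : |I - m| ≤ K / R) : k * m - K / R ≤ k * I := by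
    have := (abs_le.1 (abs_mul_le_mul hk h)).1
    linarith
  have i1 := bd (by rw [abs_pow]; exact pow_le_one₀ (abs_nonneg _) hκ1 : |κ ^ 2| ≤ 1) (hM₁ R hR)
  have i2 := bd ((abs_mul_le_mul hκ1 hz1).trans_eq (one_mul 1)) (hM₂ R hR)
  have i3 := bd (by rw [abs_pow]; exact pow_le_one₀ (abs_nonneg _) hz1 : |z ^ 2| ≤ 1) (hM₃ R hR)
  have eC : (C * (3 * δ ^ 2 + 8/3) + (K₁ + K₂ + K₃)) / R =
    C / R * (3 * δ ^ 2 + 8/3) + (K₁ / R + K₂ / R + K₃ / R) := by ring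
  rw [eC, ← hz]
  change _ ≤ _ + z * modeCoord R (fun x => r' x - Gu (Ht x) (u x)) - _ at hint
  change _ + (6/5 * z - 5/4 * κ) * modeCoord R u ≤ _ at hint
  rw [← hz] at hint
  have s1 := sq_nonneg (modeCoord R p)
  have s2 := sq_nonneg κ
  have s3 := sq_nonneg z
  linarith

theorem exists_abs_functional_le (ε : ℝ) : ∃ C : ℝ, 0 ≤ C ∧
    ∀ (R : ℝ) (u r p r' p' : ℝ → ℝ), 1 ≤ R → IsState ε u r p r' p' →
      |momentum R u r p + modeCoord R u * modeCoord R p| ≤ C := by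
  obtain ⟨K, hK1, hK⟩ := exists_common_bound [(pPsi, 0), (pG, 1), (pY, 4)]
    (by
      have d : pW ^ 1 ∣ pG := dvd_of_le (by norm_num) dvd_pG
      simpa using ⟨by simpa using d, dvd_pY⟩)
  simp only [List.forall_mem_cons, pow_zero, pow_one, mul_one] at hK
  obtain ⟨kψ, kg, kY, -⟩ := hK
  obtain ⟨E, hE⟩ : ∃ E, E = K * (3 * ε ^ 2 + 8/3) := ⟨_, rfl⟩
  have hE0 : 0 ≤ E := hE ▸ by positivity
  refine ⟨E + E * E, by positivity, fun R u r p r' p' hR hst => ?_⟩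
  have hR0 : 0 < R := by linarith
  have cu := hst.continuous_u; have cr := hst.continuous_r; have cp := hst.continuous_p
  have cH := continuous_Ht; have cQ := continuous_Qt
  have cont : Continuous fun x =>
      K * (p x ^ 2 + r x ^ 2 + Qt x ^ 2 * u x ^ 2 + (1 - Ht x ^ 2) ^ 2) := by fun_prop
  have bound {f : ℝ → ℝ} (hf : ∀ x ∈ Set.Icc (-R) R,
      |f x| ≤ K * (p x ^ 2 + r x ^ 2 + Qt x ^ 2 * u x ^ 2 + (1 - Ht x ^ 2) ^ 2)) :
      |∫ x in (-R)..R, f x| ≤ E := by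
    refine (abs_intervalIntegral_le_of_abs_le (by linarith) cont hf).trans ?_
    rw [intervalIntegral.integral_const_mul, hE]
    exact mul_le_mul_of_nonneg_left (hst.integral_energy_le _ _) (by linarith)
  have hw x := one_sub_Ht_sq_pos x
  have hw1 x : 1 - Ht x ^ 2 ≤ 1 := by linarith [sq_nonneg (Ht x)]
  have hζ {x : ℝ} (hx : x ∈ Set.Icc (-R) R) : |cutoff R x| ≤ 1 := by
    rw [abs_of_nonneg (cutoff_nonneg R x)]; exact cutoff_le_one hR0 (abs_le.2 hx)
  have hQu x : (1 - Ht x ^ 2) ^ 2 * u x ^ 2 ≤ Qt x ^ 2 * u x ^ 2 := by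
    rw [Qt_eq]
    have : 0 ≤ (1 - Ht x ^ 2) ^ 2 * u x ^ 2 := by positivity
    linarith
  have hmode {f : ℝ → ℝ} (hf : ∀ x, (1 - Ht x ^ 2) ^ 2 * f x ^ 2 ≤
      p x ^ 2 + r x ^ 2 + Qt x ^ 2 * u x ^ 2) : |modeCoord R f| ≤ E := by
    refine bound fun x hx => ?_
    have h1 := abs_mul_le_mul (abs_mul_le_mul (hζ hx) (kY _ (abs_Ht_lt_one x))) (le_refl |f x|)
    have h2 := pow_four_mul_abs_le (u := f x) (hw x).le (hw1 x)
    have h3 : (1 - Ht x ^ 2) ^ 4 * |f x| ≤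
        p x ^ 2 + r x ^ 2 + Qt x ^ 2 * u x ^ 2 + (1 - Ht x ^ 2) ^ 2 := by
      have := hf x
      have : 0 ≤ (1 - Ht x ^ 2) ^ 2 * f x ^ 2 := by positivity
      have : 0 ≤ (1 - Ht x ^ 2) ^ 2 := by positivity
      linarith
    have h4 := mul_le_mul_of_nonneg_left h3 (by linarith : 0 ≤ K)
    linarith
  have m1 : |modeCoord R u| ≤ E := hmode fun x => by
    have := hQu x; have := sq_nonneg (p x); have := sq_nonneg (r x); linarith
  have m2 : |modeCoord R p| ≤ E := hmode fun x => by
    have : (1 - Ht x ^ 2) ^ 2 * p x ^ 2 ≤ p x ^ 2 :=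
      mul_le_of_le_one_left (sq_nonneg _) (pow_le_one₀ (hw x).le (hw1 x))
    have : 0 ≤ Qt x ^ 2 * u x ^ 2 := by positivity
    have := sq_nonneg (r x); linarith
  have m3 : |momentum R u r p| ≤ E := by
    refine bound fun x hx => ?_
    have h1 := abs_mul_le_mul (abs_mul_le_mul (kψ _ (abs_Ht_lt_one x)) (hζ hx))
      (le_refl |r x * p x|)
    have h2 := abs_mul_le_mul (abs_mul_le_mul (kg _ (abs_Ht_lt_one x)) (hζ hx))
      (le_refl |u x * p x|)
    have h3 := abs_mul_abs_le (r x) (p x)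
    have h4 := abs_mul_abs_le ((1 - Ht x ^ 2) * u x) (p x)
    rw [abs_mul (1 - Ht x ^ 2), abs_of_pos (hw x)] at h4
    rw [abs_mul (r x)] at h1
    rw [abs_mul (u x)] at h2
    have h5 := mul_le_mul_of_nonneg_left h3 (by linarith : 0 ≤ K)
    have h6 := mul_le_mul_of_nonneg_left h4 (by linarith : 0 ≤ K)
    have h7 := mul_le_mul_of_nonneg_left (hQu x) (by linarith : 0 ≤ K)
    have n1 : 0 ≤ K * p x ^ 2 := by positivity
    have n2 : 0 ≤ K * r x ^ 2 := by positivity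
    have n3 : 0 ≤ K * (Qt x ^ 2 * u x ^ 2) := by positivity
    have n4 : 0 ≤ K * (1 - Ht x ^ 2) ^ 2 := by positivity
    have a1 := abs_le.1 h1
    have a2 := abs_le.1 h2
    rw [abs_le]
    constructor <;> linarith [a1.1, a1.2, a2.1, a2.2]
  exact (abs_add_le _ _).trans (add_le_add m3 (abs_mul_le_mul m1 m2))

namespace IsPerturbation

variable {ε : ℝ} {u ut ux utt utx uxx : ℝ → ℝ → ℝ}

theorem continuous_slice {G : ℝ → ℝ → ℝ}
    (hG : ContinuousOn (fun p : ℝ × ℝ => G p.1 p.2) (Set.Ioi 0 ×ˢ Set.univ)) {s : ℝ}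
    (hs : 0 < s) : Continuous (G s) := by
  rw [← continuousOn_univ]
  exact hG.comp (f := fun x => (s, x)) (by fun_prop) fun x _ => ⟨hs, trivial⟩

theorem isState (h : IsPerturbation ε u ut ux utt utx uxx) {t : ℝ} (ht : 0 < t) :
    IsState ε (u t) (ux t) (ut t) (uxx t) (utx t) where
  hu := h.u_x t ht
  hr := h.ux_x t ht
  hp := h.ut_x t ht
  hr' := continuous_slice h.cont_uxx ht
  hp' := continuous_slice h.cont_utx ht
  integrable_r := h.integrable_ux t ht
  integrable_u := h.integrable_u t ht
  integrable_p := h.integrable_ut t ht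
  integral_r := h.integral_ux t ht
  integral_u := h.integral_u t ht
  integral_p := h.integral_ut t ht

theorem hasDerivAt_functional (h : IsPerturbation ε u ut ux utt utx uxx) (R : ℝ) {t : ℝ}
    (ht : 0 < t) :
    HasDerivAt (fun t => momentum R (u t) (ux t) (ut t) + modeCoord R (u t) * modeCoord R (ut t))
      ((∫ x in (-R)..R, momentumRate R (u t) (ux t) (ut t) (uxx t) (utx t) x)
        + (modeCoord R (ut t) ^ 2
          + modeCoord R (u t) * modeCoord R fun x => uxx t x - Gu (Ht x) (u t x))) t := by
  have cu := h.cont_u; have cut := h.cont_ut; have cux := h.cont_ux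
  have cutt := h.cont_utt; have cutx := h.cont_utx
  have cψ : Continuous fun p : ℝ × ℝ => pPsi.eval (Ht p.2) :=
    (continuous_eval_Ht pPsi).comp continuous_snd
  have cg : Continuous fun p : ℝ × ℝ => pG.eval (Ht p.2) :=
    (continuous_eval_Ht pG).comp continuous_snd
  have cY : Continuous fun p : ℝ × ℝ => pY.eval (Ht p.2) :=
    (continuous_eval_Ht pY).comp continuous_snd
  have cζ : Continuous fun p : ℝ × ℝ => cutoff R p.2 := (continuous_cutoff R).comp continuous_snd
  have d1 : HasDerivAt (fun t => momentum R (u t) (ux t) (ut t))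
      (∫ x in (-R)..R, (-(pPsi.eval (Ht x) * cutoff R x * utx t x
          + 1/2 * pG.eval (Ht x) * cutoff R x * ut t x) * ut t x
        - (pPsi.eval (Ht x) * cutoff R x * ux t x
          + 1/2 * pG.eval (Ht x) * cutoff R x * u t x) * utt t x)) t := by
    refine hasDerivAt_integral_of_continuousOn (F := fun t x =>
      -(pPsi.eval (Ht x) * cutoff R x * ux t x + 1/2 * pG.eval (Ht x) * cutoff R x * u t x)
        * ut t x) (F' := fun t x => -(pPsi.eval (Ht x) * cutoff R x * utx t x
          + 1/2 * pG.eval (Ht x) * cutoff R x * ut t x) * ut t x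
        - (pPsi.eval (Ht x) * cutoff R x * ux t x
          + 1/2 * pG.eval (Ht x) * cutoff R x * u t x) * utt t x)
      (fun s hs x => ?_) (by fun_prop) (by fun_prop) _ _ ht
    refine ((((h.ux_t s hs x).const_mul (pPsi.eval (Ht x) * cutoff R x)).add
      ((h.u_t s hs x).const_mul (1/2 * pG.eval (Ht x) * cutoff R x))).neg.mul
      (h.ut_t s hs x)).congr_deriv ?_
    simp only [Pi.neg_apply, Pi.add_apply]
    ring
  have d2 : HasDerivAt (fun t => modeCoord R (u t)) (modeCoord R (ut t)) t :=
    hasDerivAt_integral_of_continuousOn (F := fun t x => cutoff R x * pY.eval (Ht x) * u t x)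
      (F' := fun t x => cutoff R x * pY.eval (Ht x) * ut t x)
      (fun s hs x => (h.u_t s hs x).const_mul _) (by fun_prop) (by fun_prop) _ _ ht
  have d3 : HasDerivAt (fun t => modeCoord R (ut t)) (modeCoord R (utt t)) t :=
    hasDerivAt_integral_of_continuousOn (F := fun t x => cutoff R x * pY.eval (Ht x) * ut t x)
      (F' := fun t x => cutoff R x * pY.eval (Ht x) * utt t x)
      (fun s hs x => (h.ut_t s hs x).const_mul _) (by fun_prop) (by fun_prop) _ _ ht
  refine (d1.add (d2.mul d3)).congr_deriv ?_
  have e : utt t = fun x => uxx t x - Gu (Ht x) (u t x) := funext (h.eqn t ht)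
  simp only [e, sq, momentumRate]

noncomputable def localEnergy (M : ℝ) (u ut ux : ℝ → ℝ → ℝ) (t : ℝ) : ℝ :=
  ∫ x in (-M)..M, (ut t x ^ 2 + ux t x ^ 2 + u t x ^ 2)

noncomputable def cutoffEnergy (M : ℝ) (u ut ux : ℝ → ℝ → ℝ) (t : ℝ) : ℝ :=
  ∫ x in (-M)..M, cutoff M x * (ut t x ^ 2 + ux t x ^ 2 + u t x ^ 2)

theorem continuousOn_localEnergy (h : IsPerturbation ε u ut ux utt utx uxx) (M : ℝ) :
    ContinuousOn (localEnergy M u ut ux) (Set.Ioi 0) := by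
  intro t ht
  have cu := h.cont_u; have cut := h.cont_ut; have cux := h.cont_ux
  have cutt := h.cont_utt; have cutx := h.cont_utx
  refine (hasDerivAt_integral_of_continuousOn
    (F := fun t x => ut t x ^ 2 + ux t x ^ 2 + u t x ^ 2)
    (F' := fun t x => 2 * ut t x * utt t x + 2 * ux t x * utx t x + 2 * u t x * ut t x)
    (fun s hs x => ?_) (by fun_prop) (by fun_prop) _ _ ht).continuousAt.continuousWithinAt
  refine ((((h.ut_t s hs x).pow 2).add ((h.ux_t s hs x).pow 2)).add
    ((h.u_t s hs x).pow 2)).congr_deriv ?_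
  simp only [Nat.cast_ofNat, Nat.add_one_sub_one, pow_one]

theorem hasDerivAt_cutoffEnergy (h : IsPerturbation ε u ut ux utt utx uxx) {M : ℝ} (hM : 0 < M)
    {t : ℝ} (ht : 0 < t) :
    HasDerivAt (cutoffEnergy M u ut ux)
      (∫ x in (-M)..M, (-2 * cutoff' M x * ux t x * ut t x
        + 2 * cutoff M x * ut t x * (u t x - Gu (Ht x) (u t x)))) t := by
  have cu := h.cont_u; have cut := h.cont_ut; have cux := h.cont_ux
  have cutt := h.cont_utt; have cutx := h.cont_utx
  have cζ : Continuous fun p : ℝ × ℝ => cutoff M p.2 := (continuous_cutoff M).comp continuous_snd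
  have d : HasDerivAt (cutoffEnergy M u ut ux) (∫ x in (-M)..M, cutoff M x *
      (2 * ut t x * utt t x + 2 * ux t x * utx t x + 2 * u t x * ut t x)) t := by
    refine hasDerivAt_integral_of_continuousOn
      (F := fun t x => cutoff M x * (ut t x ^ 2 + ux t x ^ 2 + u t x ^ 2))
      (F' := fun t x => cutoff M x *
        (2 * ut t x * utt t x + 2 * ux t x * utx t x + 2 * u t x * ut t x))
      (fun s hs x => ?_) (cζ.continuousOn.mul (by fun_prop)) (cζ.continuousOn.mul (by fun_prop))
      _ _ ht
    refine (((((h.ut_t s hs x).pow 2).add ((h.ux_t s hs x).pow 2)).add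
      ((h.u_t s hs x).pow 2)).const_mul (cutoff M x)).congr_deriv ?_
    simp only [Nat.cast_ofNat, Nat.add_one_sub_one, pow_one]
  refine d.congr_deriv ?_
  have su := continuous_slice cu ht; have sut := continuous_slice cut ht
  have sux := continuous_slice cux ht; have sutt := continuous_slice cutt ht
  have sutx := continuous_slice cutx ht; have suxx := continuous_slice h.cont_uxx ht
  have sζ := continuous_cutoff M; have sζ' := continuous_cutoff' M
  have sG := continuous_Gu su
  have i {f : ℝ → ℝ} (hf : Continuous f) : IntervalIntegrable f volume (-M) M :=
    hf.intervalIntegrable _ _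
  have key := intervalIntegral.integral_eq_sub_of_hasDerivAt (a := -M) (b := M)
    (f := fun x => 2 * cutoff M x * ux t x * ut t x)
    (f' := fun x => cutoff M x *
        (2 * ut t x * utt t x + 2 * ux t x * utx t x + 2 * u t x * ut t x)
      - (-2 * cutoff' M x * ux t x * ut t x
        + 2 * cutoff M x * ut t x * (u t x - Gu (Ht x) (u t x)))) (fun x _ => by
      refine ((((hasDerivAt_cutoff M x).const_mul 2).mul (h.ux_x t ht x)).mul
        (h.ut_x t ht x)).congr_deriv ?_
      simp only [Pi.mul_apply, h.eqn t ht x]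
      ring) (i (by fun_prop))
  rw [intervalIntegral.integral_sub (i (by fun_prop)) (i (by fun_prop))] at key
  simp only [cutoff_self hM, cutoff_neg_self hM, mul_zero, zero_mul, sub_zero] at key
  linarith

end IsPerturbation

theorem le_cutoff_of_two_mul_abs_le {R x : ℝ} (hR : 0 < R) (hx : 2 * |x| ≤ R) :
    9/16 ≤ cutoff R x := by
  have h : x ^ 2 / R ^ 2 ≤ 1/4 := by
    rw [div_le_iff₀ (by positivity), ← sq_abs x]
    nlinarith [abs_nonneg x]
  rw [cutoff]
  nlinarith

theorem exists_pos_le_one_sub_Ht_sq (M : ℝ) :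
    ∃ m > 0, ∀ x ∈ Set.Icc (-M) M, m ≤ 1 - Ht x ^ 2 := by
  have hw : Continuous fun x => 1 - Ht x ^ 2 := by have := continuous_Ht; fun_prop
  obtain hM | hM := lt_or_ge M 0
  · exact ⟨1, one_pos, fun x hx => by linarith [hx.1, hx.2]⟩
  · obtain ⟨x₀, -, hx₀⟩ := isCompact_Icc.exists_isMinOn
      (Set.nonempty_Icc.2 (by linarith : -M ≤ M)) hw.continuousOn
    exact ⟨_, one_sub_Ht_sq_pos x₀, fun x hx => hx₀ hx⟩

theorem mul_integral_le_integral_mul {f w : ℝ → ℝ} (hf : Continuous f) (hw : Continuous w)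
    (hf0 : ∀ x, 0 ≤ f x) (hw0 : ∀ x, 0 ≤ w x) {k a b c d : ℝ} (hca : c ≤ a) (hab : a ≤ b)
    (hbd : b ≤ d) (hk : ∀ x ∈ Set.Icc a b, k ≤ w x) :
    k * (∫ x in a..b, f x) ≤ ∫ x in c..d, w x * f x := by
  rw [← intervalIntegral.integral_const_mul]
  refine (intervalIntegral.integral_mono_on hab ((hf.const_mul k).intervalIntegrable _ _)
    ((hw.mul hf).intervalIntegrable _ _) fun x hx =>
      mul_le_mul_of_nonneg_right (hk x hx) (hf0 x)).trans ?_
  exact intervalIntegral.integral_mono_interval hca hab hbd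
    (ae_of_all _ fun x => mul_nonneg (hw0 x) (hf0 x)) ((hw.mul hf).intervalIntegrable _ _)

namespace IsPerturbation

variable {ε : ℝ} {u ut ux utt utx uxx : ℝ → ℝ → ℝ}

theorem continuous_energyDensity (h : IsPerturbation ε u ut ux utt utx uxx) {t : ℝ}
    (ht : 0 < t) : Continuous fun x => ut t x ^ 2 + ux t x ^ 2 + u t x ^ 2 := by
  have su := continuous_slice h.cont_u ht; have sut := continuous_slice h.cont_ut ht
  have sux := continuous_slice h.cont_ux ht
  fun_prop

theorem localEnergy_nonneg {M : ℝ} (hM : 0 ≤ M) (t : ℝ) : 0 ≤ localEnergy M u ut ux t :=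
  intervalIntegral.integral_nonneg (by linarith) fun x _ => by positivity

theorem integrableOn_localEnergy (h : IsPerturbation ε u ut ux utt utx uxx) {c C : ℝ}
    (hc : 0 < c) (hC : 0 ≤ C)
    (hvir : ∀ (R : ℝ) (u r p r' p' : ℝ → ℝ), 1 ≤ R → IsState ε u r p r' p' →
      c * (∫ x in (-R)..R, cutoff R x * ((1 - Ht x ^ 2) ^ 4 * (p x ^ 2 + r x ^ 2 + u x ^ 2)))
        - C / R ≤ (∫ x in (-R)..R, momentumRate R u r p r' p' x) + (modeCoord R p ^ 2
          + modeCoord R u * modeCoord R fun x => r' x - Gu (Ht x) (u x)))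
    {M : ℝ} (hM : 1 ≤ M) : IntegrableOn (localEnergy M u ut ux) (Set.Ioi 1) := by
  obtain ⟨m, hm, hmw⟩ := exists_pos_le_one_sub_Ht_sq M
  obtain ⟨B, hB, hJ⟩ := exists_abs_functional_le ε
  obtain ⟨k, hk⟩ : ∃ k, k = c * (9/16 * m ^ 4) := ⟨_, rfl⟩
  have hk0 : 0 < k := hk ▸ by positivity
  have cE := h.continuousOn_localEnergy M
  have cE1 (T : ℝ) : ContinuousOn (localEnergy M u ut ux) (Set.Icc 1 T) :=
    cE.mono fun s hs => one_pos.trans_le hs.1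
  refine integrableOn_Ioi_of_intervalIntegral_norm_bounded (l := atTop) (b := id)
    ((2 * B + 1) / k) 1 (fun T => ((cE1 T).integrableOn_Icc).mono_set Set.Ioc_subset_Icc_self)
    tendsto_id ?_
  filter_upwards [eventually_ge_atTop 1] with T hT
  simp only [id, Real.norm_of_nonneg (localEnergy_nonneg (by linarith : 0 ≤ M) _)]
  obtain ⟨R, hR⟩ : ∃ R, R = 2 * M + C * (T - 1) := ⟨_, rfl⟩
  have hCT : 0 ≤ C * (T - 1) := mul_nonneg hC (by linarith)
  have hR0 : 0 < R := by linarith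
  have rate {s : ℝ} (hs : 0 < s) := hvir R _ _ _ _ _ (by linarith) (h.isState hs)
  have hfun {s : ℝ} (hs : 0 < s) := abs_le.1 (hJ R _ _ _ _ _ (by linarith) (h.isState hs))
  have lower {s : ℝ} (hs : 0 < s) : k * localEnergy M u ut ux s ≤ c * ∫ x in (-R)..R,
      cutoff R x * ((1 - Ht x ^ 2) ^ 4 * (ut s x ^ 2 + ux s x ^ 2 + u s x ^ 2)) := by
    rw [hk, mul_assoc]
    refine mul_le_mul_of_nonneg_left ?_ hc.le
    have cζ := continuous_cutoff R; have cH := continuous_Ht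
    simp only [← mul_assoc (cutoff R _)]
    refine mul_integral_le_integral_mul (h.continuous_energyDensity hs) (by fun_prop)
      (fun x => by positivity)
      (fun x => mul_nonneg (cutoff_nonneg R x) (pow_nonneg (one_sub_Ht_sq_pos x).le 4))
      (by linarith) (by linarith) (by linarith) fun x hx => ?_
    exact mul_le_mul (le_cutoff_of_two_mul_abs_le hR0 (by linarith [abs_le.2 hx]))
      (pow_le_pow_left₀ hm.le (hmw x hx) 4) (by positivity) (cutoff_nonneg R x)
  have main := intervalIntegral.integral_le_sub_of_hasDeriv_right_of_le hT
    (φ := fun s => k * localEnergy M u ut ux s - C / R)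
    (fun s hs => (h.hasDerivAt_functional R
      (one_pos.trans_le hs.1)).continuousAt.continuousWithinAt)
    (fun s hs => (h.hasDerivAt_functional R (one_pos.trans hs.1)).hasDerivWithinAt)
    (((cE1 T).const_mul k).sub continuousOn_const).integrableOn_Icc
    fun s hs => by linarith [rate (one_pos.trans hs.1), lower (one_pos.trans hs.1)]
  rw [intervalIntegral.integral_sub
      (((cE1 T).const_mul k).intervalIntegrable_of_Icc hT) intervalIntegrable_const,
    intervalIntegral.integral_const_mul, intervalIntegral.integral_const, smul_eq_mul] at main
  have b1 := (hfun one_pos).1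
  have bT := (hfun (one_pos.trans_le hT)).2
  have hCR : (T - 1) * (C / R) ≤ 1 := by
    rw [← mul_div_assoc, div_le_one hR0]; linarith
  rw [le_div_iff₀ hk0]
  linarith

theorem exists_abs_Gu_le (h : IsPerturbation ε u ut ux utt utx uxx) (M : ℝ) :
    ∃ L : ℝ, 0 ≤ L ∧ ∀ t > 0, ∀ x ∈ Set.Icc (-M) M, |u t x - Gu (Ht x) (u t x)| ≤ L * |u t x| := by
  obtain ⟨m, hm, hmw⟩ := exists_pos_le_one_sub_Ht_sq M
  obtain ⟨C, hC, hsup⟩ := exists_weighted_sup_bound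
  obtain ⟨K, hK⟩ : ∃ K, K = (C * ε) ^ 2 / m := ⟨_, rfl⟩
  have hK0 : 0 ≤ K := hK ▸ by positivity
  refine ⟨1 + 9/4 * (13/2 + 5/2 * K), by positivity, fun t ht x hx => ?_⟩
  have hu : u t x ^ 2 ≤ K := by
    rw [hK, le_div_iff₀ hm]
    have := hsup (u t) (ux t) ε (h.u_x t ht) (continuous_slice h.cont_ux ht)
      (h.integrable_ux t ht) (h.integrable_u t ht) (h.integral_ux t ht) (h.integral_u t ht) x
    have := mul_le_mul_of_nonneg_right (hmw x hx) (sq_nonneg (u t x))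
    linarith
  have hw0 := one_sub_Ht_sq_pos x
  have hw1 : (1 - Ht x ^ 2) ^ 2 ≤ 1 :=
    pow_le_one₀ hw0.le (by linarith [sq_nonneg (Ht x)])
  have e : u t x - Gu (Ht x) (u t x) = (1 - 9/4 * ((1 - Ht x ^ 2) ^ 2
      * (3 * Ht x ^ 2 + 3 * (Ht x * u t x) + u t x ^ 2 - 1))) * u t x := by
    rw [Gu]; ring
  rw [e, abs_mul]
  refine mul_le_mul_of_nonneg_right ?_ (abs_nonneg _)
  have h1 : |3 * Ht x ^ 2 + 3 * (Ht x * u t x) + u t x ^ 2 - 1| ≤ 13/2 + 5/2 * K := by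
    rw [abs_le]
    constructor <;> nlinarith [sq_nonneg (Ht x + u t x), sq_nonneg (Ht x - u t x),
      sq_nonneg (Ht x), sq_nonneg (u t x)]
  have h2 := abs_mul_le_mul ((abs_of_nonneg (sq_nonneg (1 - Ht x ^ 2))).trans_le hw1) h1
  have h3 := abs_le.1 h2
  rw [abs_le]
  constructor <;> linarith [h3.1, h3.2]

theorem tendsto_cutoffEnergy (h : IsPerturbation ε u ut ux utt utx uxx) {M : ℝ} (hM : 1 ≤ M)
    (hint : IntegrableOn (localEnergy M u ut ux) (Set.Ioi 1)) :
    Tendsto (cutoffEnergy M u ut ux) atTop (nhds 0) := by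
  obtain ⟨L, hL, hGu⟩ := h.exists_abs_Gu_le M
  have hM0 : 0 < M := by linarith
  have pos {t : ℝ} (ht : t ∈ Set.Ioi 1) : 0 < t := one_pos.trans ht
  have hζ {x : ℝ} (hx : x ∈ Set.Icc (-M) M) : |cutoff M x| ≤ 1 := by
    rw [abs_of_nonneg (cutoff_nonneg M x)]; exact cutoff_le_one hM0 (abs_le.2 hx)
  have hζ' {x : ℝ} (hx : x ∈ Set.Icc (-M) M) : |cutoff' M x| ≤ 4 :=
    (abs_cutoff'_le hM0 (abs_le.2 hx)).trans (div_le_self (by norm_num) hM)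
  have hderiv : ∀ t ∈ Set.Ioi (1:ℝ), HasDerivAt (cutoffEnergy M u ut ux)
      (deriv (cutoffEnergy M u ut ux) t) t := fun t ht =>
    (h.hasDerivAt_cutoffEnergy hM0 (pos ht)).differentiableAt.hasDerivAt
  have bound {f : ℝ → ℝ} {t k : ℝ} (ht : 0 < t)
      (hf : ∀ x ∈ Set.Icc (-M) M, |f x| ≤ k * (ut t x ^ 2 + ux t x ^ 2 + u t x ^ 2)) :
      ‖∫ x in (-M)..M, f x‖ ≤ k * localEnergy M u ut ux t := by
    rw [localEnergy, ← intervalIntegral.integral_const_mul]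
    exact abs_intervalIntegral_le_of_abs_le (by linarith)
      ((h.continuous_energyDensity ht).const_mul k) hf
  refine tendsto_zero_of_hasDerivAt_of_integrableOn_Ioi hderiv ?_ ?_
  · refine (hint.const_mul (4 + L)).mono' (aestronglyMeasurable_deriv _ _) ?_
    refine (ae_restrict_iff' measurableSet_Ioi).2 (ae_of_all _ fun t ht => ?_)
    rw [(h.hasDerivAt_cutoffEnergy hM0 (pos ht)).deriv]
    refine bound (pos ht) fun x hx => ?_
    have h1 := abs_mul_le_mul (hζ' hx)
      ((abs_mul (ux t x) (ut t x)).trans_le (abs_mul_abs_le (ux t x) (ut t x)))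
    have h2 := abs_mul_le_mul (hζ hx) (abs_mul_le_mul (le_refl |ut t x|)
      (hGu t (pos ht) x hx))
    have h3 := mul_le_mul_of_nonneg_left (abs_mul_abs_le (ut t x) (u t x)) hL
    have n1 := mul_nonneg hL (sq_nonneg (ux t x))
    have a1 := abs_le.1 h1
    have a2 := abs_le.1 h2
    rw [abs_le]
    constructor <;>
      linarith [a1.1, a1.2, a2.1, a2.2, sq_nonneg (u t x), sq_nonneg (ut t x), sq_nonneg (ux t x)]
  · refine hint.mono' (ContinuousOn.aestronglyMeasurable
      (fun t ht => (hderiv t ht).continuousAt.continuousWithinAt) measurableSet_Ioi) ?_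
    refine (ae_restrict_iff' measurableSet_Ioi).2 (ae_of_all _ fun t ht => ?_)
    rw [← one_mul (localEnergy M u ut ux t)]
    refine bound (pos ht) fun x hx => ?_
    rw [abs_mul, abs_of_nonneg (by positivity : 0 ≤ ut t x ^ 2 + ux t x ^ 2 + u t x ^ 2)]
    exact mul_le_mul_of_nonneg_right (hζ hx) (by positivity)

theorem tendsto_setIntegral_Icc (h : IsPerturbation ε u ut ux utt utx uxx)
    (hlim : ∀ M ≥ 1, Tendsto (cutoffEnergy M u ut ux) atTop (nhds 0)) (a b : ℝ) :
    Tendsto (fun t => ∫ x in Set.Icc a b, (u t x ^ 2 + ux t x ^ 2 + ut t x ^ 2)) atTop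
      (nhds 0) := by
  obtain hab | hab := lt_or_ge b a
  · simp [Set.Icc_eq_empty_of_lt hab]
  obtain ⟨M, hM⟩ : ∃ M, M = 2 * (|a| + |b|) + 1 := ⟨_, rfl⟩
  have ha := abs_nonneg a; have hb := abs_nonneg b
  have hM1 : 1 ≤ M := by linarith
  have h0 := (hlim M hM1).const_mul (16/9)
  rw [mul_zero] at h0
  refine squeeze_zero' (Eventually.of_forall fun t => setIntegral_nonneg measurableSet_Icc
    fun x _ => by positivity) ?_ h0
  filter_upwards [eventually_gt_atTop 0] with t ht
  have key := mul_integral_le_integral_mul (k := 9/16) (h.continuous_energyDensity ht)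
    (continuous_cutoff M) (fun x => by positivity) (cutoff_nonneg M)
    (by linarith [neg_abs_le a] : -M ≤ a) hab (by linarith [le_abs_self b] : b ≤ M)
    fun x hx => le_cutoff_of_two_mul_abs_le (by linarith) (by
      have : |x| ≤ |a| + |b| := abs_le.2
        ⟨by linarith [hx.1, neg_abs_le a], by linarith [hx.2, le_abs_self b]⟩
      linarith)
  rw [integral_Icc_eq_integral_Ioc, ← intervalIntegral.integral_of_le hab]
  rw [← cutoffEnergy] at key
  have e : ∫ x in a..b, (u t x ^ 2 + ux t x ^ 2 + ut t x ^ 2)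
      = ∫ x in a..b, (ut t x ^ 2 + ux t x ^ 2 + u t x ^ 2) := by
    congr 1 with x; ring
  linarith

end IsPerturbation

end Kink

/-- Conditional asymptotic stability of the kink `Ht` for the
variable-coefficient wave equation `∂ₜ²φ − ∂ₓ²φ − Q̃²(φ − φ³) = 0`. -/
theorem kink_asymptotic_stability :
    ∃ δ > (0:ℝ), ∀ φ : ℝ → ℝ → ℝ,
      ContDiffOn ℝ 2 (fun p : ℝ × ℝ => φ p.1 p.2) (Set.Ici (0:ℝ) ×ˢ Set.univ) →
      (∀ t ≥ (0:ℝ), ∀ x : ℝ,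
        deriv (deriv (fun s => φ s x)) t - deriv (deriv (fun y => φ t y)) x
          - (Qt x)^2 * (φ t x - (φ t x)^3) = 0) →
      (∀ t ≥ (0:ℝ),
        Integrable (fun x => (deriv (fun y => φ t y) x - deriv Ht x)^2) ∧
        Integrable (fun x => (Qt x * (φ t x - Ht x))^2) ∧
        Integrable (fun x => (Qt x * (1 - (φ t x)^2))^2) ∧
        Integrable (fun x => (deriv (fun s => φ s x) t)^2)) →
      (∀ t ≥ (0:ℝ),
        Real.sqrt ((∫ x, (deriv (fun y => φ t y) x - deriv Ht x)^2)
          + (∫ x, (Qt x)^2 * (φ t x - Ht x)^2)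
          + (∫ x, (deriv (fun s => φ s x) t)^2)) < δ) →
      ∀ a b : ℝ,
        Filter.Tendsto (fun t => ∫ x in Set.Icc a b,
          ((φ t x - Ht x)^2 + (deriv (fun y => φ t y) x - deriv Ht x)^2
            + (deriv (fun s => φ s x) t)^2)) Filter.atTop (nhds 0) := by
  obtain ⟨δ, hδ, c, hc, C, hC, hvir⟩ := Kink.exists_virial_lower_bound
  refine ⟨δ, hδ, fun φ hφ heq hint hsmall a b => ?_⟩
  obtain ⟨utt, utx, uxx, h⟩ := Kink.exists_isPerturbation hφ heq hint hsmall
  exact h.tendsto_setIntegral_Icc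
    (fun M hM => h.tendsto_cutoffEnergy hM (h.integrableOn_localEnergy hc hC hvir hM)) a b
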